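/- arXiv:1104.2371 — 2 statements merged into one kernel-verified Lean document; each statement's English description precedes it below -/
import Mathlib

section
/- The group K_{n,k,l} is generated by the finite set S_K = {M_{x^ε,y} : x ∈ X, y ∈ Y, ε = ±1} ∪ {C_{z,y} : z ∈ Z, y ∈ Y} ∪ {C_{y,v} : y ∈ Y, v ∈ X ∪ Y ∪ Z, v ≠ y}. -/
namespace Birman

/-- The generating set of the free group `F_{n,k,l}`: `X ∪ Y ∪ Z`. -/
abbrev Gen (n k l : ℕ) := Fin n ⊕ (Fin k ⊕ Fin l)

/-- The free group `F_{n,k,l}` on `X ∪ Y ∪ Z`. -/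
abbrev FG (n k l : ℕ) := FreeGroup (Gen n k l)

variable {n k l : ℕ}

/-- The generator `x_i`. -/
def xg (n k l : ℕ) (i : Fin n) : Gen n k l := Sum.inl i
/-- The generator `y_j`. -/
def yg (n k l : ℕ) (j : Fin k) : Gen n k l := Sum.inr (Sum.inl j)
/-- The generator `z_m`. -/
def zg (n k l : ℕ) (m : Fin l) : Gen n k l := Sum.inr (Sum.inr m)

/-- `A_{n,k,l}`: automorphisms sending each generator in `Y ∪ Z` to a conjugate of itself. -/
def A (n k l : ℕ) : Subgroup (MulAut (FG n k l)) where
  carrier := {f | ∀ s : Fin k ⊕ Fin l,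
    IsConj (FreeGroup.of (Sum.inr s : Gen n k l)) (f (FreeGroup.of (Sum.inr s)))}
  one_mem' := by
    intro s
    rw [MulAut.one_apply]
  mul_mem' := by
    intro f g hf hg s
    rw [MulAut.mul_apply]
    exact (hf s).trans (f.toMonoidHom.map_isConj (hg s))
  inv_mem' := by
    intro f hf s
    have h := (f⁻¹ : MulAut (FG n k l)).toMonoidHom.map_isConj (hf s)
    simp only [MulEquiv.toMonoidHom_eq_coe, MonoidHom.coe_coe] at h
    have h2 : (f⁻¹ : MulAut (FG n k l)) (f (FreeGroup.of (Sum.inr s))) = FreeGroup.of (Sum.inr s) :=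
      MulAut.inv_apply_self _ f _
    rw [h2] at h
    exact h.symm

/-- The projection `F_{n,k,l} → F_{n,0,l}` killing the generators in `Y`. -/
def proj (n k l : ℕ) : FG n k l →* FG n 0 l :=
  FreeGroup.lift fun g => match g with
    | Sum.inl i => FreeGroup.of (Sum.inl i)
    | Sum.inr (Sum.inl _) => 1
    | Sum.inr (Sum.inr m) => FreeGroup.of (Sum.inr (Sum.inr m))

/-- Automorphisms commuting with the projection to `F_{n,0,l}`, i.e. inducing the identity
on `F_{n,k,l}/N ≅ F_{n,0,l}`. -/
def fixProj (n k l : ℕ) : Subgroup (MulAut (FG n k l)) where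
  carrier := {f | ∀ w : FG n k l, proj n k l (f w) = proj n k l w}
  one_mem' := by intro w; simp
  mul_mem' := by
    intro f g hf hg w
    rw [MulAut.mul_apply]
    exact (hf (g w)).trans (hg w)
  inv_mem' := by
    intro f hf w
    have h := hf ((f⁻¹ : MulAut (FG n k l)) w)
    rw [MulAut.apply_inv_self] at h
    exact h.symm

/-- `K_{n,k,l}`, the kernel of `ρ : A_{n,k,l} → A_{n,0,l}`: those elements of `A_{n,k,l}`
that induce the identity automorphism of `F_{n,k,l}/N ≅ F_{n,0,l}`. -/
def K (n k l : ℕ) : Subgroup (MulAut (FG n k l)) := A n k l ⊓ fixProj n k l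

/-- `f` is the automorphism `M_{v,w}` : `v ↦ w v`, fixing all other generators. -/
def IsMul (f : MulAut (FG n k l)) (v w : Gen n k l) : Prop :=
  f (FreeGroup.of v) = FreeGroup.of w * FreeGroup.of v ∧
    ∀ u : Gen n k l, u ≠ v → f (FreeGroup.of u) = FreeGroup.of u

/-- `f` is the automorphism `M_{v⁻¹,w}` : `v ↦ v w⁻¹`, fixing all other generators. -/
def IsMulInv (f : MulAut (FG n k l)) (v w : Gen n k l) : Prop :=
  f (FreeGroup.of v) = FreeGroup.of v * (FreeGroup.of w)⁻¹ ∧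
    ∀ u : Gen n k l, u ≠ v → f (FreeGroup.of u) = FreeGroup.of u

/-- `f` is the automorphism `C_{v,w}` : `v ↦ w v w⁻¹`, fixing all other generators. -/
def IsConjGen (f : MulAut (FG n k l)) (v w : Gen n k l) : Prop :=
  f (FreeGroup.of v) = FreeGroup.of w * FreeGroup.of v * (FreeGroup.of w)⁻¹ ∧
    ∀ u : Gen n k l, u ≠ v → f (FreeGroup.of u) = FreeGroup.of u

end Birman

namespace Birman

/-- The finite generating set `S_K` of Theorem A:
`{M_{x^ε,y}} ∪ {C_{z,y}} ∪ {C_{y,v} : v ≠ y}`. -/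
def SK (n k l : ℕ) : Set (MulAut (FG n k l)) :=
  {f | ∃ (i : Fin n) (j : Fin k),
      IsMul f (xg n k l i) (yg n k l j) ∨ IsMulInv f (xg n k l i) (yg n k l j)} ∪
  {f | ∃ (m : Fin l) (j : Fin k), IsConjGen f (zg n k l m) (yg n k l j)} ∪
  {f | ∃ (j : Fin k) (u : Gen n k l), u ≠ yg n k l j ∧ IsConjGen f (yg n k l j) u}

end Birman
/-! ### Words in free groups: common prefixes and Gromov products -/

namespace Nielsen

open FreeGroup

variable {α : Type*} [DecidableEq α]

theorem exists_lcp {β : Type*} [DecidableEq β] (l₁ l₂ : List β) :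
    ∃ p s t, l₁ = p ++ s ∧ l₂ = p ++ t ∧ ∀ a ∈ s.head?, ∀ b ∈ t.head?, a ≠ b := by
  induction l₁ generalizing l₂ with
  | nil => exact ⟨[], [], l₂, by simp⟩
  | cons x xs ih =>
    cases l₂ with
    | nil => exact ⟨[], x :: xs, [], by simp⟩
    | cons y ys =>
      by_cases h : x = y
      · subst h
        obtain ⟨p, s, t, h1, h2, h3⟩ := ih ys
        exact ⟨x :: p, s, t, by simp [h1], by simp [h2], h3⟩
      · exact ⟨[], x :: xs, y :: ys, by simp, by simp, by simpa using h⟩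

theorem toWord_mk_of_isReduced {L : List (α × Bool)} (h : FreeGroup.IsReduced L) :
    (FreeGroup.mk L).toWord = L := by
  rw [toWord_mk, h.reduce_eq]

theorem isReduced_invRev {L : List (α × Bool)} (h : FreeGroup.IsReduced L) : FreeGroup.IsReduced (invRev L) := by
  rw [isReduced_iff_reduce_eq] at *
  rw [reduce_invRev, h]

theorem split (u v : FreeGroup α) : ∃ p s t, u.toWord = p ++ s ∧ v.toWord = p ++ t ∧
    (u⁻¹ * v).toWord = invRev s ++ t := by
  obtain ⟨p, s, t, h1, h2, h3⟩ := exists_lcp u.toWord v.toWord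
  refine ⟨p, s, t, h1, h2, ?_⟩
  have hs : FreeGroup.IsReduced s := by
    have h := isReduced_toWord (x := u)
    rw [h1] at h
    exact (List.isChain_append.1 h).2.1
  have ht : FreeGroup.IsReduced t := by
    have h := isReduced_toWord (x := v)
    rw [h2] at h
    exact (List.isChain_append.1 h).2.1
  have hu : u = mk p * mk s := by rw [mul_mk, ← h1, mk_toWord]
  have hv : v = mk p * mk t := by rw [mul_mk, ← h2, mk_toWord]
  have : u⁻¹ * v = mk (invRev s ++ t) := by
    rw [← mul_mk, ← inv_mk, hu, hv]; group
  rw [this, toWord_mk_of_isReduced]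
  have hs' := isReduced_invRev hs
  unfold FreeGroup.IsReduced at *
  rw [List.isChain_append]
  refine ⟨hs', ht, ?_⟩
  intro x hx y hy hxy
  cases s with
  | nil => simp at hx
  | cons a s =>
    have := h3 a (by simp) y hy
    simp [invRev] at hx
    subst hx
    simp only at hxy
    by_contra hne
    apply this
    ext
    · exact hxy
    · revert hne; simp only; cases a.2 <;> cases y.2 <;> simp

/-- Gromov product: the length of the common prefix. -/
def cp (u v : FreeGroup α) : ℕ := (u.norm + v.norm - (u⁻¹ * v).norm) / 2

theorem cp_spec' (u v : FreeGroup α) : ∃ p s t, u.toWord = p ++ s ∧ v.toWord = p ++ t ∧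
    (u⁻¹ * v).toWord = invRev s ++ t ∧ p.length = cp u v := by
  obtain ⟨p, s, t, h1, h2, h3⟩ := split u v
  refine ⟨p, s, t, h1, h2, h3, ?_⟩
  simp only [cp, FreeGroup.norm, h1, h2, h3, List.length_append, invRev_length]
  omega

theorem cp_norm (u v : FreeGroup α) : (u⁻¹ * v).norm + 2 * cp u v = u.norm + v.norm := by
  obtain ⟨p, s, t, h1, h2, h3, h4⟩ := cp_spec' u v
  rw [← h4]
  simp only [FreeGroup.norm, h1, h2, h3, List.length_append, invRev_length]
  omega

theorem cp_norm' (u v : FreeGroup α) : (u * v).norm + 2 * cp u⁻¹ v = u.norm + v.norm := by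
  have := cp_norm u⁻¹ v
  rwa [inv_inv, norm_inv_eq] at this

theorem cp_comm (u v : FreeGroup α) : cp u v = cp v u := by
  have h1 := cp_norm u v
  have h2 := cp_norm v u
  have : (u⁻¹ * v).norm = (v⁻¹ * u).norm := by
    rw [← norm_inv_eq]; congr 1; group
  omega

theorem le_cp {u v : FreeGroup α} {p : List (α × Bool)} (hu : p <+: u.toWord)
    (hv : p <+: v.toWord) : p.length ≤ cp u v := by
  obtain ⟨s, hs⟩ := hu
  obtain ⟨t, ht⟩ := hv
  have hu : u = mk p * mk s := by rw [mul_mk, hs, mk_toWord]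
  have hv : v = mk p * mk t := by rw [mul_mk, ht, mk_toWord]
  have h1 : u⁻¹ * v = mk (invRev s ++ t) := by
    rw [← mul_mk, ← inv_mk, hu, hv]; group
  have h2 : (u⁻¹ * v).norm ≤ s.length + t.length := by
    rw [h1]; refine norm_mk_le.trans ?_; simp
  have h3 := cp_norm u v
  have h4 : u.norm = p.length + s.length := by rw [FreeGroup.norm, ← hs, List.length_append]
  have h5 : v.norm = p.length + t.length := by rw [FreeGroup.norm, ← ht, List.length_append]
  omega

theorem exists_cp (u v : FreeGroup α) : ∃ p, p <+: u.toWord ∧ p <+: v.toWord ∧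
    p.length = cp u v := by
  obtain ⟨p, s, t, h1, h2, h3, h4⟩ := cp_spec' u v
  exact ⟨p, ⟨s, h1.symm⟩, ⟨t, h2.symm⟩, h4⟩

theorem cp_ultra (u v w : FreeGroup α) : min (cp u v) (cp v w) ≤ cp u w := by
  obtain ⟨p, h1, h2, h3⟩ := exists_cp u v
  obtain ⟨q, h4, h5, h6⟩ := exists_cp v w
  rcases le_total p.length q.length with h | h
  · have := List.prefix_of_prefix_length_le h2 h4 h
    have := le_cp h1 (this.trans h5)
    omega
  · have := List.prefix_of_prefix_length_le h4 h2 h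
    have := le_cp (this.trans h1) h5
    omega

theorem cp_iso {u v w : FreeGroup α} (h : cp u v < cp v w) : cp u w = cp u v := by
  have h1 := cp_ultra u v w
  have h2 := cp_ultra u w v
  rw [cp_comm w v] at h2
  omega

theorem cp_self_lt {u : FreeGroup α} (hu : u ≠ 1) : 2 * cp u⁻¹ u < u.norm := by
  have h := cp_norm' u u
  have hr := reduceCyclically.reduce_flatten_replicate_succ (isReduced_toWord (x := u)) 1
  have hc := reduceCyclically.conj_conjugator_reduceCyclically u.toWord
  have h2 : (u * u).norm = (reduceCyclically.conjugator u.toWord).length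
      + (2 * (reduceCyclically u.toWord).length)
      + (reduceCyclically.conjugator u.toWord).length := by
    rw [FreeGroup.norm, toWord_mul]
    simp only [List.replicate, List.flatten_cons, List.flatten_nil, List.append_nil] at hr
    rw [hr]
    simp; omega
  have h3 : u.norm = (reduceCyclically.conjugator u.toWord).length
      + (reduceCyclically u.toWord).length
      + (reduceCyclically.conjugator u.toWord).length := by
    rw [FreeGroup.norm]; conv_lhs => rw [← hc]
    simp; omega
  have h4 : 0 < (reduceCyclically u.toWord).length := by
    rw [List.length_pos_iff]
    intro h0
    apply hu
    have : u.toWord = reduceCyclically.conjugator u.toWord ++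
      invRev (reduceCyclically.conjugator u.toWord) := by
      conv_lhs => rw [← hc, h0]
      simp
    rw [← mk_toWord (x := u), this, ← mul_mk, ← inv_mk]
    exact mul_inv_cancel _
  omega

/-- The Nielsen property propagates to products. -/
theorem chain_aux (U : α × Bool → FreeGroup α)
    (h1 : ∀ a b : α × Bool, (a.1 = b.1 → a.2 = b.2) → cp (U a)⁻¹ (U b) < (U a).norm)
    (h2 : ∀ a b c : α × Bool, (a.1 = b.1 → a.2 = b.2) → (b.1 = c.1 → b.2 = c.2) →
      cp (U a)⁻¹ (U b) + cp (U b)⁻¹ (U c) < (U b).norm)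
    (h3 : ∀ a b : α × Bool, (a.1 = b.1 → a.2 = b.2) → cp (U a)⁻¹ (U b) < (U b).norm)
    (h0 : ∀ a, 0 < (U a).norm)
    (L : List (α × Bool)) : ∀ b, FreeGroup.IsReduced (b :: L) →
    ∃ c, c < (U b).norm ∧ (∀ a, (a.1 = b.1 → a.2 = b.2) → cp (U a)⁻¹ (U b) + c < (U b).norm) ∧
      cp ((b :: L).map U).prod (U b) + c = (U b).norm ∧
      L.length + (U b).norm ≤ ((b :: L).map U).prod.norm + c := by
  induction L with
  | nil =>
    intro b _
    refine ⟨0, h0 b, fun a hab => by simpa using h3 a b hab, ?_, by simp⟩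
    have := cp_norm (U b) (U b)
    simp at this ⊢
    omega
  | cons b L ih =>
    intro a hL
    rw [FreeGroup.isReduced_cons_cons] at hL
    obtain ⟨hab, hL⟩ := hL
    obtain ⟨c, hc, hc1, hc2, hc3⟩ := ih b hL
    set g := ((b :: L).map U).prod with hg
    have hprod : ((a :: b :: L).map U).prod = U a * g := by simp [hg]
    rw [hprod]
    have e1 : cp (U a)⁻¹ g = cp (U a)⁻¹ (U b) := by
      apply cp_iso
      have := hc1 a hab
      rw [cp_comm (U b)]
      omega
    have e2 := cp_norm' (U a) g
    have e3 := cp_norm (U a * g) (U a)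
    have e4 : ((U a * g)⁻¹ * U a).norm = g.norm := by
      rw [← norm_inv_eq (x := g)]; congr 1; group
    have e5 := hc1 a hab
    refine ⟨cp (U a)⁻¹ (U b), h1 a b hab, fun a' ha' => h2 a' a b ha' hab, ?_, ?_⟩
    · omega
    · simp only [List.length_cons]
      omega

theorem chain_norm (U : α × Bool → FreeGroup α)
    (h1 : ∀ a b : α × Bool, (a.1 = b.1 → a.2 = b.2) → cp (U a)⁻¹ (U b) < (U a).norm)
    (h2 : ∀ a b c : α × Bool, (a.1 = b.1 → a.2 = b.2) → (b.1 = c.1 → b.2 = c.2) →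
      cp (U a)⁻¹ (U b) + cp (U b)⁻¹ (U c) < (U b).norm)
    (h3 : ∀ a b : α × Bool, (a.1 = b.1 → a.2 = b.2) → cp (U a)⁻¹ (U b) < (U b).norm)
    (h0 : ∀ a, 0 < (U a).norm)
    (L : List (α × Bool)) (hL : FreeGroup.IsReduced L) : L.length ≤ (L.map U).prod.norm := by
  cases L with
  | nil => simp
  | cons b L =>
    obtain ⟨c, hc, -, -, h⟩ := chain_aux U h1 h2 h3 h0 L b hL
    simp only [List.length_cons]
    omega

/-! ### Rank functions on words -/

/-- A rank function on words: digits in some base. -/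
def rho (B : ℕ) (e : α × Bool → ℕ) (L : List (α × Bool)) : ℕ := Nat.ofDigits B (L.map e)

theorem rho_append (B : ℕ) (e : α × Bool → ℕ) (L M : List (α × Bool)) :
    rho B e (L ++ M) = rho B e L + B ^ L.length * rho B e M := by
  simp [rho, Nat.ofDigits_append]

theorem rho_inj {B : ℕ} {e : α × Bool → ℕ} (hB : 1 < B) (he : Function.Injective e)
    (heB : ∀ a, e a < B) {L M : List (α × Bool)} (hl : L.length = M.length)
    (h : rho B e L = rho B e M) : L = M := by
  have := Nat.ofDigits_inj_of_len_eq hB (by simpa using hl) (by intro l hl; obtain ⟨a, -, rfl⟩ := List.mem_map.1 hl; apply heB)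
    (by intro l hl; obtain ⟨a, -, rfl⟩ := List.mem_map.1 hl; apply heB) h
  exact he.list_map this

/-- Initial half. -/
def hl (u : FreeGroup α) : List (α × Bool) := u.toWord.take (u.norm / 2)

/-- Rank of an element: sum of the ranks of the initial halves of `u` and `u⁻¹`. -/
def rk (B : ℕ) (e : α × Bool → ℕ) (u : FreeGroup α) : ℕ := rho B e (hl u) + rho B e (hl u⁻¹)

theorem rk_inv (B : ℕ) (e : α × Bool → ℕ) (u : FreeGroup α) : rk B e u⁻¹ = rk B e u := by
  simp [rk, add_comm]

theorem swap {v w : FreeGroup α} (h : 2 * cp v⁻¹ w = v.norm) :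
    ∃ s, w.toWord = hl v⁻¹ ++ s ∧ (v * w).toWord = hl v ++ s := by
  obtain ⟨p, s, t, h1, h2, h3, h4⟩ := cp_spec' v⁻¹ w
  have hv : v.toWord = invRev s ++ invRev p := by
    have := congrArg invRev h1
    rwa [toWord_inv, invRev_invRev, invRev_append] at this
  have hn : v.norm = s.length + p.length := by simp [FreeGroup.norm, hv]
  have e1 : hl v⁻¹ = p := by
    rw [hl, h1, norm_inv_eq]
    rw [List.take_append_of_le_length (by omega), List.take_of_length_le (by omega)]
  have e2 : hl v = invRev s := by
    rw [hl, hv, List.take_append_of_le_length (by simp; omega),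
      List.take_of_length_le (by simp; omega)]
  refine ⟨t, by rw [e1, h2], by rw [e2, ← h3, inv_inv]⟩

theorem hl_length (u : FreeGroup α) : (hl u).length = u.norm / 2 := by
  simp [hl, FreeGroup.norm]; omega

theorem eq_one_of_hl {u : FreeGroup α} (hu : Even u.norm) (h : hl u = hl u⁻¹) : u = 1 := by
  have h1 : u.toWord = hl u ++ invRev (hl u⁻¹) := by
    obtain ⟨m, hm⟩ := hu
    conv_lhs => rw [← List.take_append_drop m u.toWord]
    have : u.norm / 2 = m := by omega
    rw [hl, hl, norm_inv_eq, this]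
    congr 1
    rw [toWord_inv, invRev, invRev]
    rw [List.take_reverse, List.map_reverse, List.reverse_reverse, List.length_map, ← List.map_drop,
      List.map_map]
    have : u.toWord.length - m = m := by
      have : u.toWord.length = m + m := hm
      omega
    simp [this, Function.comp_def]
  rw [← mk_toWord (x := u), h1, ← mul_mk, ← inv_mk, h]
  exact mul_inv_cancel _

theorem rk_swap (B : ℕ) (e : α × Bool → ℕ) {v w : FreeGroup α} (h : 2 * cp v⁻¹ w = v.norm)
    (hw : v.norm ≤ w.norm) :
    rk B e (v * w) + rho B e (hl v⁻¹) = rk B e w + rho B e (hl v) := by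
  obtain ⟨s, h1, h2⟩ := swap h
  have hn := cp_norm' v w
  have hn' : (v * w).norm = w.norm := by omega
  have l1 := hl_length v
  have l2 := hl_length v⁻¹
  rw [norm_inv_eq] at l2
  have ls : w.norm = v.norm / 2 + s.length := by rw [FreeGroup.norm, h1, List.length_append, l2]
  have t1 : hl w = hl v⁻¹ ++ s.take (w.norm / 2 - v.norm / 2) := by
    rw [hl, h1, List.take_append, l2, List.take_of_length_le (by omega)]
  have t2 : hl (v * w) = hl v ++ s.take (w.norm / 2 - v.norm / 2) := by
    rw [hl, h2, hn', List.take_append, l1, List.take_of_length_le (by omega)]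
  have t3 : hl w⁻¹ = (invRev s).take (w.norm / 2) := by
    rw [hl, toWord_inv, h1, invRev_append, norm_inv_eq, List.take_append_of_le_length]
    simp; omega
  have t4 : hl (v * w)⁻¹ = (invRev s).take (w.norm / 2) := by
    rw [hl, toWord_inv, h2, invRev_append, norm_inv_eq, hn', List.take_append_of_le_length]
    simp; omega
  rw [rk, rk, t1, t2, t3, t4, rho_append, rho_append, l1, l2]
  ring

end Nielsen

namespace Nielsen

open FreeGroup

variable {α : Type*} [DecidableEq α]

/-! ### Conjugates of generators -/

theorem isReduced_snoc {g : FreeGroup α} {a : α} (h : ∀ x ∈ g.toWord.getLast?, x.1 ≠ a)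
    (b : Bool) : FreeGroup.IsReduced (g.toWord ++ [(a, b)]) := by
  have hg := isReduced_toWord (x := g)
  unfold FreeGroup.IsReduced at *
  rw [List.isChain_append]
  refine ⟨hg, by simp, ?_⟩
  intro x hx y hy hxy
  simp at hy
  subst hy
  exact absurd hxy (h x hx)

theorem isReduced_conj {g : FreeGroup α} {a : α} (h : ∀ x ∈ g.toWord.getLast?, x.1 ≠ a)
    (b : Bool) : FreeGroup.IsReduced (g.toWord ++ (a, b) :: invRev g.toWord) := by
  have h1 := isReduced_snoc h b
  have h2 := isReduced_invRev (isReduced_snoc h (!b))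
  rw [invRev_append] at h2
  have h3 : invRev [(a, !b)] = [(a, b)] := by simp [invRev]
  rw [h3] at h2
  have := FreeGroup.IsReduced.append_overlap h1 h2 (by simp)
  simpa using this

theorem conj_word_aux {a : α} (N : ℕ) : ∀ c : FreeGroup α, c.norm ≤ N →
    ∃ g : FreeGroup α, (c * of a * c⁻¹).toWord = g.toWord ++ (a, true) :: invRev g.toWord := by
  induction N with
  | zero =>
    intro c hc
    have : c = 1 := by rw [← FreeGroup.norm_eq_zero]; omega
    subst this
    exact ⟨1, by simp⟩
  | succ N ih =>
    intro c hc
    by_cases h : ∀ x ∈ c.toWord.getLast?, x.1 ≠ a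
    · refine ⟨c, ?_⟩
      have h1 := isReduced_conj h true
      rw [← toWord_mk_of_isReduced h1]
      congr 1
      rw [← mul_mk, ← List.singleton_append, ← mul_mk, ← inv_mk, mk_toWord, ← mul_assoc]
      rfl
    · push Not at h
      obtain ⟨⟨x, b⟩, hx, rfl⟩ := h
      obtain ⟨l, hl⟩ := List.mem_getLast?_eq_getLast hx |> fun ⟨h, h'⟩ =>
        (⟨c.toWord.dropLast, by rw [h']; exact (List.dropLast_append_getLast h).symm⟩ :
          ∃ l, c.toWord = l ++ [(x, b)])
      have hc2 : c = mk l * mk [(x, b)] := by rw [mul_mk, ← hl, mk_toWord]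
      have hn : (mk l).norm ≤ N := by
        have : c.norm = l.length + 1 := by simp [FreeGroup.norm, hl]
        have := norm_mk_le (L₁ := l)
        omega
      have := ih (mk l) hn
      have e : c * of x * c⁻¹ = mk l * of x * (mk l)⁻¹ := by
        rw [hc2]
        have hx : mk [(x, b)] = of x ∨ mk [(x, b)] = (of x)⁻¹ := by
          cases b
          · right; rfl
          · left; rfl
        rcases hx with hx | hx <;> rw [hx] <;> group
      rw [e]
      exact this

theorem conj_word {a : α} {u : FreeGroup α} (h : IsConj (of a) u) :
    ∃ g : FreeGroup α, u.toWord = g.toWord ++ (a, true) :: invRev g.toWord := by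
  obtain ⟨c, rfl⟩ := isConj_iff.1 h
  exact conj_word_aux _ c le_rfl

/-- The value of a family on a letter. -/
def lw (U : α → FreeGroup α) (x : α × Bool) : FreeGroup α := cond x.2 (U x.1) (U x.1)⁻¹

theorem lw_inv (U : α → FreeGroup α) (x : α × Bool) : lw U (x.1, !x.2) = (lw U x)⁻¹ := by
  rcases x with ⟨x, b⟩; cases b <;> simp [lw]

theorem conj_word_lw {U : α → FreeGroup α} (x : α × Bool) (h : IsConj (of x.1) (U x.1)) :
    ∃ g : FreeGroup α, (lw U x).toWord = g.toWord ++ x :: invRev g.toWord := by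
  obtain ⟨g, hg⟩ := conj_word h
  refine ⟨g, ?_⟩
  rcases x with ⟨x, b⟩
  cases b
  · simp only [lw, cond_false]
    rw [toWord_inv]
    simp only at hg
    rw [hg, invRev_append, invRev_cons, invRev_invRev]
    simp [invRev]
  · simpa [lw] using hg

/-- The (strict) order on elements: first by length, then by rank. -/
def mlt (B : ℕ) (e : α × Bool → ℕ) (u v : FreeGroup α) : Prop :=
  u.norm < v.norm ∨ (u.norm = v.norm ∧ rk B e u < rk B e v)

theorem cp_prefix {x g w : FreeGroup α} (h : g.toWord <+: w.toWord) (hc : cp x w ≤ g.norm) :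
    cp x g = cp x w := by
  apply le_antisymm
  · obtain ⟨p, h1, h2, h3⟩ := exists_cp x g
    rw [← h3]
    exact le_cp h1 (h2.trans h)
  · obtain ⟨p, h1, h2, h3⟩ := exists_cp x w
    rw [← h3]
    exact le_cp h1 (List.prefix_of_prefix_length_le h2 h (by rw [h3]; exact hc))

/-- An irreducible family. -/
structure Irr (B : ℕ) (e : α × Bool → ℕ) (C : α → Prop) (U : α → FreeGroup α) : Prop where
  hX : ∀ a : α × Bool, ¬ C a.1 → ∀ b : α × Bool, b.1 ≠ a.1 → ¬ mlt B e (lw U b * lw U a) (lw U a)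
  hC : ∀ a : α × Bool, C a.1 → ∀ b : α × Bool, b.1 ≠ a.1 →
    ¬ mlt B e (lw U b * lw U a * (lw U b)⁻¹) (lw U a)
  hW : ∀ a : α, C a → IsConj (of a) (U a)
  h1 : ∀ a, U a ≠ 1

namespace Irr

variable {B : ℕ} {e : α × Bool → ℕ} {C : α → Prop} {U : α → FreeGroup α}

theorem conj_form {w g : FreeGroup α} {a : α × Bool}
    (hg : w.toWord = g.toWord ++ a :: invRev g.toWord) : w = g * FreeGroup.mk [a] * g⁻¹ := by
  rw [← mk_toWord (x := w), hg, ← mul_mk, ← List.singleton_append, ← mul_mk, ← inv_mk,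
    mk_toWord, ← mul_assoc]

theorem conj_norm {w g : FreeGroup α} {a : α × Bool}
    (hg : w.toWord = g.toWord ++ a :: invRev g.toWord) : w.norm = 2 * g.norm + 1 := by
  simp [FreeGroup.norm, hg]; omega

theorem conj_mul_eq {v w g : FreeGroup α} {a : α × Bool}
    (hg : w.toWord = g.toWord ++ a :: invRev g.toWord) :
    v * w * v⁻¹ = FreeGroup.mk ((v * g).toWord ++ a :: invRev (v * g).toWord) := by
  rw [conj_form hg, ← mul_mk, ← List.singleton_append (l := invRev (v * g).toWord), ← mul_mk,
    ← inv_mk, mk_toWord]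
  group

theorem conj_mul_norm_le {v w g : FreeGroup α} {a : α × Bool}
    (hg : w.toWord = g.toWord ++ a :: invRev g.toWord) :
    (v * w * v⁻¹).norm ≤ 2 * (v * g).norm + 1 := by
  rw [conj_mul_eq hg]
  refine norm_mk_le.trans ?_
  simp [FreeGroup.norm]; omega

theorem hg_le (H : Irr B e C U) {a b : α × Bool} (ha : C a.1) (hab : b.1 ≠ a.1) {g : FreeGroup α}
    (hg : (lw U a).toWord = g.toWord ++ a :: invRev g.toWord) :
    g.norm ≤ (lw U b * g).norm := by
  by_contra hlt
  apply H.hC a ha b hab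
  left
  have := conj_mul_norm_le (v := lw U b) hg
  have := conj_norm hg
  omega

theorem C1_CC (H : Irr B e C U) {a b : α × Bool} (hab : b.1 ≠ a.1) (ha : C a.1)
    {g h : FreeGroup α} (hg : (lw U a).toWord = g.toWord ++ a :: invRev g.toWord)
    (hh : (lw U b)⁻¹.toWord = h.toWord ++ (b.1, !b.2) :: invRev h.toWord)
    (hlt : h.norm < g.norm) (hc : h.norm < cp (lw U b)⁻¹ (lw U a)) : False := by
  have := H.hg_le ha hab hg
  have h1 := cp_norm' (lw U b) g
  have h2 := conj_norm hh
  rw [norm_inv_eq] at h2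
  obtain ⟨p, hp1, hp2, hp3⟩ := exists_cp (lw U b)⁻¹ (lw U a)
  have q1 : h.toWord ++ [(b.1, !b.2)] <+: (lw U b)⁻¹.toWord := by rw [hh]; simp
  have ql : (h.toWord ++ [(b.1, !b.2)]).length = h.norm + 1 := by simp [FreeGroup.norm]
  have q2 : h.toWord ++ [(b.1, !b.2)] <+: p :=
    List.prefix_of_prefix_length_le q1 hp1 (by omega)
  have q3 : h.toWord ++ [(b.1, !b.2)] <+: g.toWord := by
    refine List.prefix_of_prefix_length_le (q2.trans hp2) (by rw [hg]; simp) ?_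
    rw [ql]; exact hlt
  have := le_cp q1 q3
  omega

theorem C1 (H : Irr B e C U) {a b : α × Bool} (hab : b.1 ≠ a.1) :
    2 * cp (lw U b)⁻¹ (lw U a) ≤ (lw U b).norm := by
  have hn := cp_norm' (lw U b) (lw U a)
  by_cases ha : C a.1
  · by_contra hlt
    obtain ⟨g, hg⟩ := conj_word_lw a (H.hW _ ha)
    have hgn := conj_norm hg
    have hgw : g.toWord <+: (lw U a).toWord := by rw [hg]; simp
    by_cases hc : cp (lw U b)⁻¹ (lw U a) ≤ g.norm
    · have h1 := cp_prefix hgw hc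
      have h2 := H.hg_le ha hab hg
      have h3 := cp_norm' (lw U b) g
      omega
    · push Not at hc
      by_cases hb : C b.1
      · obtain ⟨h, hh⟩ := conj_word_lw (b.1, !b.2) (H.hW _ hb)
        rw [lw_inv] at hh
        have hhn := conj_norm hh
        rw [norm_inv_eq] at hhn
        rcases lt_trichotomy h.norm g.norm with hl | hl | hl
        · exact H.C1_CC hab ha hg hh hl (by omega)
        · obtain ⟨p, hp1, hp2, hp3⟩ := exists_cp (lw U b)⁻¹ (lw U a)
          have q1 : h.toWord ++ [(b.1, !b.2)] <+: p := by
            refine List.prefix_of_prefix_length_le (l₃ := (lw U b)⁻¹.toWord)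
              (by rw [hh]; simp) hp1 ?_
            have : (h.toWord ++ [(b.1, !b.2)]).length = h.norm + 1 := by simp [FreeGroup.norm]
            omega
          have q2 : g.toWord ++ [a] <+: p := by
            refine List.prefix_of_prefix_length_le (l₃ := (lw U a).toWord)
              (by rw [hg]; simp) hp2 ?_
            have : (g.toWord ++ [a]).length = g.norm + 1 := by simp [FreeGroup.norm]
            omega
          have q3 := List.prefix_of_prefix_length_le q1 q2
            (by simp only [List.length_append, List.length_singleton]; exact Nat.succ_le_succ hl.le)
          have q4 := q3.eq_of_length (by
            simp only [List.length_append, List.length_singleton]; exact congrArg Nat.succ hl)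
          have q5 := (List.append_inj' q4 rfl).2
          simp only [List.cons.injEq, and_true] at q5
          rw [← q5] at hab
          exact hab rfl
        · have e1 : (lw U (a.1, !a.2))⁻¹ = lw U a := by rw [lw_inv, inv_inv]
          refine H.C1_CC (a := (b.1, !b.2)) (b := (a.1, !a.2)) hab.symm hb (h := g) (g := h)
            ?_ ?_ hl ?_
          · rw [lw_inv, hh]
          · rw [e1, hg]; simp
          · rw [e1, lw_inv, cp_comm]; exact hc
      · apply H.hX (b.1, !b.2) hb (a.1, !a.2) hab.symm
        left
        rw [lw_inv, lw_inv, ← mul_inv_rev, norm_inv_eq, norm_inv_eq]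
        omega
  · by_contra hlt
    apply H.hX a ha b hab
    left
    omega

theorem C1' (H : Irr B e C U) {a b : α × Bool} (hab : b.1 ≠ a.1) :
    2 * cp (lw U b)⁻¹ (lw U a) ≤ (lw U a).norm := by
  have := H.C1 (a := (b.1, !b.2)) (b := (a.1, !a.2)) hab.symm
  rw [lw_inv, lw_inv, inv_inv, norm_inv_eq, cp_comm] at this
  exact this

theorem hl_conj {w g : FreeGroup α} {a : α × Bool}
    (hg : w.toWord = g.toWord ++ a :: invRev g.toWord) : hl w = g.toWord := by
  have := conj_norm hg
  rw [hl, hg]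
  have h2 : w.norm / 2 = g.toWord.length := by
    have : g.norm = g.toWord.length := rfl
    omega
  rw [h2]; simp

theorem rk_conj {w g : FreeGroup α} {a : α × Bool}
    (hg : w.toWord = g.toWord ++ a :: invRev g.toWord) : rk B e w = 2 * rho B e g.toWord := by
  have h2 : w⁻¹.toWord = g.toWord ++ (a.1, !a.2) :: invRev g.toWord := by
    rw [toWord_inv, hg, invRev_append, invRev_cons, invRev_invRev]
    simp [invRev]
  rw [rk, hl_conj hg, hl_conj h2]; ring

theorem C2 (H : Irr B e C U) {a b : α × Bool} (hab : b.1 ≠ a.1)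
    (h : 2 * cp (lw U b)⁻¹ (lw U a) = (lw U b).norm) :
    rho B e (hl (lw U b)⁻¹) ≤ rho B e (hl (lw U b)) := by
  have h' := H.C1' hab
  have hn := cp_norm' (lw U b) (lw U a)
  by_cases ha : C a.1
  · by_contra hlt
    push Not at hlt
    obtain ⟨g, hg⟩ := conj_word_lw a (H.hW _ ha)
    have hgn := conj_norm hg
    have hgw : g.toWord <+: (lw U a).toWord := by rw [hg]; simp
    have hcg : cp (lw U b)⁻¹ g = cp (lw U b)⁻¹ (lw U a) := cp_prefix hgw (by omega)
    obtain ⟨s, hs1, hs2⟩ := swap (v := lw U b) (w := g) (by omega)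
    have hng := cp_norm' (lw U b) g
    have hle := conj_mul_norm_le (v := lw U b) hg
    apply H.hC a ha b hab
    by_cases hne : (lw U b * lw U a * (lw U b)⁻¹).norm = (lw U a).norm
    · right
      refine ⟨hne, ?_⟩
      have hw : (lw U b * lw U a * (lw U b)⁻¹).toWord =
          (lw U b * g).toWord ++ a :: invRev (lw U b * g).toWord := by
        rw [FreeGroup.norm, conj_mul_eq hg, toWord_mk] at hne
        rw [conj_mul_eq hg, toWord_mk]
        refine List.Sublist.eq_of_length (reduce.red.sublist) ?_
        rw [hne]
        have : (lw U b * g).norm = (lw U b * g).toWord.length := rfl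
        simp
        omega
      rw [rk_conj hg, rk_conj hw, hs1, hs2, rho_append, rho_append, hl_length, hl_length,
        norm_inv_eq]
      omega
    · left; omega
  · by_contra hlt
    apply H.hX a ha b hab
    right
    have := rk_swap B e h (by omega)
    omega

theorem lw_ne_one (H : Irr B e C U) (a : α × Bool) : lw U a ≠ 1 := by
  have := H.h1 a.1
  rcases a with ⟨a, b⟩; cases b <;> simpa [lw] using this

theorem eq_of_ok {a b : α × Bool} (h : a.1 = b.1 → a.2 = b.2) (hab : a.1 = b.1) : a = b :=
  Prod.ext hab (h hab)

theorem N1 (H : Irr B e C U) {a b : α × Bool} (h : a.1 = b.1 → a.2 = b.2) :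
    2 * cp (lw U a)⁻¹ (lw U b) ≤ (lw U a).norm ∧ 2 * cp (lw U a)⁻¹ (lw U b) ≤ (lw U b).norm := by
  by_cases hab : a.1 = b.1
  · have := eq_of_ok h hab
    subst this
    have := cp_self_lt (H.lw_ne_one a)
    omega
  · exact ⟨H.C1 hab, H.C1' hab⟩

theorem N2 (H : Irr B e C U) (hB : 1 < B) (he : Function.Injective e)
    (heB : ∀ a, e a < B) {a b c : α × Bool} (hab : a.1 = b.1 → a.2 = b.2)
    (hbc : b.1 = c.1 → b.2 = c.2) :
    cp (lw U a)⁻¹ (lw U b) + cp (lw U b)⁻¹ (lw U c) < (lw U b).norm := by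
  have h1 := (H.N1 hab).2
  have h2 := (H.N1 hbc).1
  by_contra hlt
  have e1 : 2 * cp (lw U a)⁻¹ (lw U b) = (lw U b).norm := by omega
  have e2 : 2 * cp (lw U b)⁻¹ (lw U c) = (lw U b).norm := by omega
  have n1 : a.1 ≠ b.1 := by
    intro h
    have := eq_of_ok hab h
    subst this
    have := cp_self_lt (H.lw_ne_one a)
    omega
  have n2 : b.1 ≠ c.1 := by
    intro h
    have := eq_of_ok hbc h
    subst this
    have := cp_self_lt (H.lw_ne_one b)
    omega
  have r1 := H.C2 n2 e2
  have r2 := H.C2 (a := (a.1, !a.2)) (b := (b.1, !b.2)) n1.symm (by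
    rw [lw_inv, lw_inv, inv_inv, norm_inv_eq, cp_comm]; exact e1)
  rw [lw_inv, inv_inv] at r2
  have := rho_inj hB he heB (by rw [hl_length, hl_length, norm_inv_eq]) (le_antisymm r2 r1)
  exact H.lw_ne_one b (eq_one_of_hl ⟨cp (lw U b)⁻¹ (lw U c), by omega⟩ this)

theorem norm_le (H : Irr B e C U) (hB : 1 < B) (he : Function.Injective e)
    (heB : ∀ a, e a < B) (w : FreeGroup α) : w.norm ≤ (FreeGroup.lift U w).norm := by
  have h0 : ∀ a, 0 < (lw U a).norm := fun a => by
    rw [Nat.pos_iff_ne_zero, Ne, FreeGroup.norm_eq_zero]; exact H.lw_ne_one a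
  have := chain_norm (lw U) (fun a b hab => by have := H.N1 hab; have := h0 a; omega)
    (fun a b c hab hbc => H.N2 hB he heB hab hbc)
    (fun a b hab => by have := H.N1 hab; have := h0 b; omega) h0 w.toWord isReduced_toWord
  have e1 : FreeGroup.lift U w = (w.toWord.map (lw U)).prod := by
    conv_lhs => rw [← mk_toWord (x := w)]
    rw [lift_mk]; rfl
  rw [e1]
  exact this

end Irr

end Nielsen

namespace Nielsen

open FreeGroup hiding map_mul map_inv map_one

variable {α : Type*} [DecidableEq α]

/-! ### Elementary automorphisms -/

/-- The element of the free group given by a letter. -/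
def ell (b : α × Bool) : FreeGroup α := cond b.2 (of b.1) (of b.1)⁻¹

@[simp] theorem ell_true (a : α) : ell (a, true) = of a := rfl
@[simp] theorem ell_false (a : α) : ell (a, false) = (of a)⁻¹ := rfl

theorem aut_ext {f g : MulAut (FreeGroup α)} (h : ∀ u, f (of u) = g (of u)) : f = g := by
  have : f.toMonoidHom = g.toMonoidHom := FreeGroup.ext_hom _ _ h
  ext w
  exact DFunLike.congr_fun this w

/-- The endomorphism `v ↦ g v h`. -/
def tvHom (v : α) (g h : FreeGroup α) : FreeGroup α →* FreeGroup α :=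
  FreeGroup.lift fun u => if u = v then g * of u * h else of u

theorem tvHom_of (v : α) (g h : FreeGroup α) (u : α) :
    tvHom v g h (of u) = if u = v then g * of u * h else of u := by
  simp [tvHom]

theorem tvHom_ell (v : α) (g h : FreeGroup α) {b : α × Bool} (hb : b.1 ≠ v) :
    tvHom v g h (ell b) = ell b := by
  have hb2 : b.1 ≠ v := hb
  rcases b with ⟨b, _ | _⟩ <;> simp_all [tvHom_of]

/-- The automorphism `v ↦ g v h` for `g`, `h` not involving `v`. -/
def tv (v : α) (g h : FreeGroup α)
    (hg : ∀ g' h', tvHom v g' h' g = g) (hh : ∀ g' h', tvHom v g' h' h = h) :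
    MulAut (FreeGroup α) :=
  MonoidHom.toMulEquiv (tvHom v g h) (tvHom v g⁻¹ h⁻¹)
    (by
      apply FreeGroup.ext_hom
      intro u
      simp only [MonoidHom.comp_apply, tvHom_of, MonoidHom.id_apply]
      split_ifs with h1
      · simp only [map_mul, hg, hh, tvHom_of, h1, if_true]; group
      · simp [tvHom_of, h1])
    (by
      apply FreeGroup.ext_hom
      intro u
      simp only [MonoidHom.comp_apply, tvHom_of, MonoidHom.id_apply]
      split_ifs with h1
      · simp only [map_mul, map_inv, hg, hh, tvHom_of, h1, if_true]; group
      · simp [tvHom_of, h1])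

theorem tv_of (v : α) (g h : FreeGroup α)
    (hg : ∀ g' h', tvHom v g' h' g = g) (hh : ∀ g' h', tvHom v g' h' h = h) (u : α) :
    tv v g h hg hh (of u) = if u = v then g * of u * h else of u := tvHom_of _ _ _ _

/-- `v ↦ b v`. -/
def Lm (v : α) (b : α × Bool) (hb : b.1 ≠ v) : MulAut (FreeGroup α) :=
  tv v (ell b) 1 (fun _ _ => tvHom_ell _ _ _ hb) (fun _ _ => map_one _)

/-- `v ↦ v b`. -/
def Rm (v : α) (b : α × Bool) (hb : b.1 ≠ v) : MulAut (FreeGroup α) :=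
  tv v 1 (ell b) (fun _ _ => map_one _) (fun _ _ => tvHom_ell _ _ _ hb)

/-- `v ↦ b v b⁻¹`. -/
def Cm (v : α) (b : α × Bool) (hb : b.1 ≠ v) : MulAut (FreeGroup α) :=
  tv v (ell b) (ell b)⁻¹ (fun _ _ => tvHom_ell _ _ _ hb)
    (fun _ _ => by rw [map_inv, tvHom_ell _ _ _ hb])

theorem Lm_of (v : α) (b : α × Bool) (hb : b.1 ≠ v) (u : α) :
    Lm v b hb (of u) = if u = v then ell b * of u else of u := by
  simp [Lm, tv_of]

theorem Rm_of (v : α) (b : α × Bool) (hb : b.1 ≠ v) (u : α) :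
    Rm v b hb (of u) = if u = v then of u * ell b else of u := by
  simp [Rm, tv_of]

theorem Cm_of (v : α) (b : α × Bool) (hb : b.1 ≠ v) (u : α) :
    Cm v b hb (of u) = if u = v then ell b * of u * (ell b)⁻¹ else of u := by
  simp [Cm, tv_of]

theorem Lm_ell (v : α) (b : α × Bool) (hb : b.1 ≠ v) : Lm v b hb (ell b) = ell b :=
  tvHom_ell _ _ _ hb

theorem Rm_ell (v : α) (b : α × Bool) (hb : b.1 ≠ v) : Rm v b hb (ell b) = ell b :=
  tvHom_ell _ _ _ hb

theorem Cm_ell (v : α) (b : α × Bool) (hb : b.1 ≠ v) : Cm v b hb (ell b) = ell b :=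
  tvHom_ell _ _ _ hb

theorem ell_not (b : α × Bool) : ell (b.1, !b.2) = (ell b)⁻¹ := by
  rcases b with ⟨b, _ | _⟩ <;> simp

theorem Lm_inv (v : α) (b : α × Bool) (hb : b.1 ≠ v) : (Lm v b hb)⁻¹ = Lm v (b.1, !b.2) hb := by
  rw [inv_eq_iff_mul_eq_one]
  apply aut_ext
  intro u
  simp only [MulAut.mul_apply, Lm_of, MulAut.one_apply, ell_not]
  split_ifs with h
  · simp [Lm_ell, Lm_of, h]
  · simp [Lm_of, h]

theorem Rm_inv (v : α) (b : α × Bool) (hb : b.1 ≠ v) : (Rm v b hb)⁻¹ = Rm v (b.1, !b.2) hb := by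
  rw [inv_eq_iff_mul_eq_one]
  apply aut_ext
  intro u
  simp only [MulAut.mul_apply, Rm_of, MulAut.one_apply, ell_not]
  split_ifs with h
  · simp [Rm_ell, Rm_of, h]
  · simp [Rm_of, h]

theorem Cm_inv (v : α) (b : α × Bool) (hb : b.1 ≠ v) : (Cm v b hb)⁻¹ = Cm v (b.1, !b.2) hb := by
  rw [inv_eq_iff_mul_eq_one]
  apply aut_ext
  intro u
  simp only [MulAut.mul_apply, Cm_of, MulAut.one_apply, ell_not]
  split_ifs with h
  · simp [Cm_ell, Cm_of, h, mul_assoc]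
  · simp [Cm_of, h]

/-- The inversion `v ↦ v⁻¹`. -/
def invHom (v : α) : FreeGroup α →* FreeGroup α :=
  FreeGroup.lift fun u => if u = v then (of u)⁻¹ else of u

theorem invHom_of (v u : α) : invHom v (of u) = if u = v then (of u)⁻¹ else of u := by
  simp [invHom]

theorem invHom_invHom (v : α) : (invHom v).comp (invHom v) = MonoidHom.id _ := by
  apply FreeGroup.ext_hom
  intro u
  simp only [MonoidHom.comp_apply, invHom_of, MonoidHom.id_apply]
  split_ifs with h <;> simp [invHom_of, h]

/-- The inversion `v ↦ v⁻¹`. -/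
def Im (v : α) : MulAut (FreeGroup α) :=
  MonoidHom.toMulEquiv (invHom v) (invHom v) (invHom_invHom v) (invHom_invHom v)

theorem Im_of (v u : α) : Im v (of u) = if u = v then (of u)⁻¹ else of u := invHom_of v u

theorem Im_inv (v : α) : (Im v)⁻¹ = Im v := by
  rw [inv_eq_iff_mul_eq_one]
  apply aut_ext
  intro u
  simp only [MulAut.mul_apply, Im_of, MulAut.one_apply]
  split_ifs with h <;> simp [Im_of, h]

theorem Rm_eq (v : α) (b : α × Bool) (hb : b.1 ≠ v) :
    Rm v b hb = Im v * Lm v (b.1, !b.2) hb * Im v := by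
  apply aut_ext
  intro u
  rcases b with ⟨b, _ | _⟩
  all_goals
    have hb' : b ≠ v := hb
    simp only [MulAut.mul_apply, Im_of, Rm_of]
    split_ifs with h
    · subst h; simp [Lm_of, Im_of, hb']
    · simp [Lm_of, Im_of, h]

theorem of_eq_of_or {u v : α} (h : of u = of v ∨ of u = (of v)⁻¹) : u = v := by
  rcases h with h | h
  · exact of_injective h
  · have := congrArg toWord h
    simp [toWord_inv, invRev] at this

theorem eq_ell_of_norm {g : FreeGroup α} (h : g.norm = 1) : ∃ b, g = ell b := by
  obtain ⟨b, hb⟩ := List.length_eq_one_iff.1 h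
  refine ⟨b, ?_⟩
  rw [← mk_toWord (x := g), hb]
  rcases b with ⟨b, _ | _⟩ <;> rfl

theorem toWord_ell (b : α × Bool) : (ell b).toWord = [b] := by
  rcases b with ⟨b, _ | _⟩ <;> simp [toWord_inv, invRev]

end Nielsen

namespace Birman

open FreeGroup hiding map_mul map_inv map_one
open Nielsen

variable {n k l : ℕ}

/-- The subgroup generated by `SK`. -/
abbrev Lg (n k l : ℕ) : Subgroup (MulAut (FG n k l)) := Subgroup.closure (SK n k l)

/-- The generators `x`. -/
abbrev gx (i : Fin n) : Gen n k l := Sum.inl i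
/-- The generators `y`. -/
abbrev gy (j : Fin k) : Gen n k l := Sum.inr (Sum.inl j)
/-- The generators `z`. -/
abbrev gz (m : Fin l) : Gen n k l := Sum.inr (Sum.inr m)

theorem Lm_mem (i : Fin n) (j : Fin k) (ε : Bool) :
    Lm (gx i : Gen n k l) (gy j, ε) (by simp) ∈ Lg n k l := by
  have h : Lm (gx i : Gen n k l) (gy j, true) (by simp) ∈ Lg n k l := by
    apply Subgroup.subset_closure
    left; left
    refine ⟨i, j, Or.inl ⟨by simp [Lm_of, xg, yg], fun u hu => ?_⟩⟩
    rw [Lm_of]; exact if_neg hu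
  cases ε
  · have := inv_mem h
    rwa [Lm_inv] at this
  · exact h

theorem Rm_mem (i : Fin n) (j : Fin k) (ε : Bool) :
    Rm (gx i : Gen n k l) (gy j, ε) (by simp) ∈ Lg n k l := by
  have h : Rm (gx i : Gen n k l) (gy j, false) (by simp) ∈ Lg n k l := by
    apply Subgroup.subset_closure
    left; left
    refine ⟨i, j, Or.inr ⟨by simp [Rm_of, xg, yg], fun u hu => ?_⟩⟩
    rw [Rm_of]; exact if_neg hu
  cases ε
  · exact h
  · have := inv_mem h
    rwa [Rm_inv] at this

theorem Cz_mem (m : Fin l) (j : Fin k) (ε : Bool) :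
    Cm (gz m : Gen n k l) (gy j, ε) (by simp) ∈ Lg n k l := by
  have h : Cm (gz m : Gen n k l) (gy j, true) (by simp) ∈ Lg n k l := by
    apply Subgroup.subset_closure
    left; right
    refine ⟨m, j, ⟨by simp [Cm_of, zg, yg], fun u hu => ?_⟩⟩
    rw [Cm_of]; exact if_neg hu
  cases ε
  · have := inv_mem h
    rwa [Cm_inv] at this
  · exact h

theorem Cy_mem (j : Fin k) (b : Gen n k l × Bool) (hb : b.1 ≠ gy j) :
    Cm (gy j : Gen n k l) b hb ∈ Lg n k l := by
  obtain ⟨v, ε⟩ := b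
  have h : Cm (gy j : Gen n k l) (v, true) hb ∈ Lg n k l := by
    apply Subgroup.subset_closure
    right
    refine ⟨j, v, hb, ⟨by simp [Cm_of, yg], fun u hu => ?_⟩⟩
    rw [Cm_of]; exact if_neg hu
  cases ε
  · have := inv_mem h
    rwa [Cm_inv] at this
  · exact h

theorem SK_cases {P : MulAut (FG n k l) → Prop}
    (h1 : ∀ i j, P (Lm (gx i) (gy j, true) (by simp)))
    (h2 : ∀ i j, P (Rm (gx i) (gy j, false) (by simp)))
    (h3 : ∀ m j, P (Cm (gz m) (gy j, true) (by simp)))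
    (h4 : ∀ j v (hv : v ≠ gy j), P (Cm (gy j) (v, true) hv)) :
    ∀ t ∈ SK n k l, P t := by
  rintro t ((⟨i, j, ⟨ha, hb⟩ | ⟨ha, hb⟩⟩ | ⟨m, j, ha, hb⟩) | ⟨j, u, hu, ha, hb⟩)
  · convert h1 i j using 1
    apply aut_ext
    intro v
    rw [Lm_of]
    split_ifs with h
    · subst h; exact ha
    · exact hb v h
  · convert h2 i j using 1
    apply aut_ext
    intro v
    rw [Rm_of]
    split_ifs with h
    · subst h; exact ha
    · exact hb v h
  · convert h3 m j using 1
    apply aut_ext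
    intro v
    rw [Cm_of]
    split_ifs with h
    · subst h; exact ha
    · exact hb v h
  · have hu' : u ≠ gy j := hu
    convert h4 j u hu' using 1
    apply aut_ext
    intro v
    rw [Cm_of]
    split_ifs with h
    · subst h; exact ha
    · exact hb v h

/-- The subgroup generated by `X ∪ Z`. -/
def Tg (n k l : ℕ) : Subgroup (FG n k l) := Subgroup.closure {g | ∃ u : Gen n k l,
  (∀ j, u ≠ gy j) ∧ g = of u}

/-- Automorphisms that normalise `Lg` (half of it), fix `Y` and preserve `Tg`. -/
structure HG (s : MulAut (FG n k l)) : Prop where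
  a : ∀ t ∈ Lg n k l, s * t * s⁻¹ ∈ Lg n k l
  b : ∀ j : Fin k, s (of (gy j)) = of (gy j)
  c : ∀ w ∈ Tg n k l, s w ∈ Tg n k l

theorem HG.of_gen {s : MulAut (FG n k l)} (a : ∀ t ∈ SK n k l, s * t * s⁻¹ ∈ Lg n k l)
    (b : ∀ j : Fin k, s (of (gy j)) = of (gy j))
    (c : ∀ u : Gen n k l, (∀ j, u ≠ gy j) → s (of u) ∈ Tg n k l) : HG s where
  a := by
    intro t ht
    have : Lg n k l ≤ (Lg n k l).comap (MulAut.conj s).toMonoidHom := by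
      rw [Subgroup.closure_le]
      intro t ht
      simpa using a t ht
    simpa using this ht
  b := b
  c := by
    intro w hw
    have : Tg n k l ≤ (Tg n k l).comap s.toMonoidHom := by
      rw [Tg, Subgroup.closure_le]
      rintro _ ⟨u, hu, rfl⟩
      exact c u hu
    exact this hw

theorem HG.mul {s s' : MulAut (FG n k l)} (h : HG s) (h' : HG s') : HG (s * s') where
  a := by
    intro t ht
    have := h.a _ (h'.a t ht)
    have e : s * (s' * t * s'⁻¹) * s⁻¹ = s * s' * t * (s * s')⁻¹ := by group
    rwa [e] at this
  b := by intro j; rw [MulAut.mul_apply, h'.b, h.b]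
  c := by intro w hw; exact h.c _ (h'.c _ hw)

theorem conj_mem_of {s t t' : MulAut (FG n k l)} (h : s * t = t' * s) (ht : t' ∈ Lg n k l) :
    s * t * s⁻¹ ∈ Lg n k l := by
  rw [h]; simpa using ht

theorem of_mem_Tg {u : Gen n k l} (hu : ∀ j, u ≠ gy j) : of u ∈ Tg n k l :=
  Subgroup.subset_closure ⟨u, hu, rfl⟩

theorem ell_mem_Tg {b : Gen n k l × Bool} (hb : ∀ j, b.1 ≠ gy j) : ell b ∈ Tg n k l := by
  rcases b with ⟨b, _ | _⟩
  · exact inv_mem (of_mem_Tg hb)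
  · exact of_mem_Tg hb

end Birman
set_option linter.unusedSimpArgs false

namespace Nielsen

open FreeGroup hiding map_mul map_inv map_one

variable {α : Type*} [DecidableEq α]

/-! ### Commutation relations -/

theorem tv_comm {v v' : α} {g h g' h' : FreeGroup α} (hv : v ≠ v')
    (hg hh hg' hh')
    (k1 : ∀ a b, tvHom v' a b g = g) (k2 : ∀ a b, tvHom v' a b h = h)
    (k3 : ∀ a b, tvHom v a b g' = g') (k4 : ∀ a b, tvHom v a b h' = h') :
    tv v g h hg hh * tv v' g' h' hg' hh' = tv v' g' h' hg' hh' * tv v g h hg hh := by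
  apply aut_ext
  intro u
  have e : ∀ w, tv v g h hg hh w = tvHom v g h w := fun _ => rfl
  have e' : ∀ w, tv v' g' h' hg' hh' w = tvHom v' g' h' w := fun _ => rfl
  simp only [MulAut.mul_apply, e, e', tvHom_of]
  by_cases h1 : u = v
  · subst h1
    simp [tvHom_of, hv, k1, k2]
  · by_cases h2 : u = v'
    · subst h2
      simp [tvHom_of, h1, k3, k4]
    · simp [tvHom_of, h1, h2]

theorem tvHom_ell_inv (v : α) (g h : FreeGroup α) {b : α × Bool} (hb : b.1 ≠ v) :
    tvHom v g h (ell b)⁻¹ = (ell b)⁻¹ := by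
  rw [map_inv, tvHom_ell _ _ _ hb]

/-- Commutation of left multiplications with disjoint supports. -/
theorem LL_comm {v v' : α} {b b' : α × Bool} (hb hb') (hv : v ≠ v') (h1 : b.1 ≠ v')
    (h2 : b'.1 ≠ v) : Lm v b hb * Lm v' b' hb' = Lm v' b' hb' * Lm v b hb := by
  unfold Lm
  apply tv_comm hv <;> intros <;> simp [tvHom_ell, h1, h2]

theorem LR_comm {v v' : α} {b b' : α × Bool} (hb hb') (hv : v ≠ v') (h1 : b.1 ≠ v')
    (h2 : b'.1 ≠ v) : Lm v b hb * Rm v' b' hb' = Rm v' b' hb' * Lm v b hb := by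
  unfold Lm Rm
  apply tv_comm hv <;> intros <;> simp [tvHom_ell, h1, h2]

theorem LC_comm {v v' : α} {b b' : α × Bool} (hb hb') (hv : v ≠ v') (h1 : b.1 ≠ v')
    (h2 : b'.1 ≠ v) : Lm v b hb * Cm v' b' hb' = Cm v' b' hb' * Lm v b hb := by
  unfold Lm Cm
  apply tv_comm hv <;> intros <;> simp [tvHom_ell, h1, h2]

theorem CR_comm {v v' : α} {b b' : α × Bool} (hb hb') (hv : v ≠ v') (h1 : b.1 ≠ v')
    (h2 : b'.1 ≠ v) : Cm v b hb * Rm v' b' hb' = Rm v' b' hb' * Cm v b hb := by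
  unfold Cm Rm
  apply tv_comm hv <;> intros <;> simp [tvHom_ell, h1, h2]

theorem CC_comm {v v' : α} {b b' : α × Bool} (hb hb') (hv : v ≠ v') (h1 : b.1 ≠ v')
    (h2 : b'.1 ≠ v) : Cm v b hb * Cm v' b' hb' = Cm v' b' hb' * Cm v b hb := by
  unfold Cm
  apply tv_comm hv <;> intros <;> simp [tvHom_ell, h1, h2]

theorem Lm_ell' (v : α) (b : α × Bool) (hb : b.1 ≠ v) {c : α × Bool} (hc : c.1 ≠ v) :
    Lm v b hb (ell c) = ell c := tvHom_ell _ _ _ hc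

theorem Rm_ell' (v : α) (b : α × Bool) (hb : b.1 ≠ v) {c : α × Bool} (hc : c.1 ≠ v) :
    Rm v b hb (ell c) = ell c := tvHom_ell _ _ _ hc

theorem Cm_ell' (v : α) (b : α × Bool) (hb : b.1 ≠ v) {c : α × Bool} (hc : c.1 ≠ v) :
    Cm v b hb (ell c) = ell c := tvHom_ell _ _ _ hc

theorem Lm_self (v : α) (b : α × Bool) (hb : b.1 ≠ v) :
    Lm v b hb (of v) = ell b * of v := by simp [Lm_of]

theorem Rm_self (v : α) (b : α × Bool) (hb : b.1 ≠ v) :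
    Rm v b hb (of v) = of v * ell b := by simp [Rm_of]

theorem Cm_self (v : α) (b : α × Bool) (hb : b.1 ≠ v) :
    Cm v b hb (of v) = ell b * of v * (ell b)⁻¹ := by simp [Cm_of]

theorem Lm_ne {v u : α} (b : α × Bool) (hb : b.1 ≠ v) (hu : u ≠ v) :
    Lm v b hb (of u) = of u := by simp [Lm_of, hu]

theorem Rm_ne {v u : α} (b : α × Bool) (hb : b.1 ≠ v) (hu : u ≠ v) :
    Rm v b hb (of u) = of u := by simp [Rm_of, hu]

theorem Cm_ne {v u : α} (b : α × Bool) (hb : b.1 ≠ v) (hu : u ≠ v) :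
    Cm v b hb (of u) = of u := by simp [Cm_of, hu]

theorem LR_comm_same {v : α} {b b' : α × Bool} (hb hb') :
    Lm v b hb * Rm v b' hb' = Rm v b' hb' * Lm v b hb := by
  apply aut_ext
  intro u
  by_cases h : u = v
  · subst h
    simp [Lm_self, Rm_self, Lm_ell' _ _ _ hb', Rm_ell' _ _ _ hb, mul_assoc]
  · simp [Lm_ne, Rm_ne, h]

section rel

variable {v a y : α} (hva : v ≠ a) (hvy : v ≠ y) (hay : a ≠ y)

/-- Extensionality for automorphisms, with the three special generators separated. -/
theorem rel_ext {f g : MulAut (FreeGroup α)} (v a y : α) (h1 : f (of v) = g (of v))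
    (h2 : f (of a) = g (of a)) (h3 : f (of y) = g (of y))
    (h4 : ∀ u, u ≠ v → u ≠ a → u ≠ y → f (of u) = g (of u)) : f = g := by
  apply aut_ext
  intro u
  by_cases e1 : u = v
  · rw [e1, h1]
  by_cases e2 : u = a
  · rw [e2, h2]
  by_cases e3 : u = y
  · rw [e3, h3]
  exact h4 u e1 e2 e3


/-! Relations with `s = Lm v (a, ε)` -/

theorem relL1 (ε δ : Bool) : Lm v (a, ε) hva.symm * Lm v (y, δ) hvy.symm =
    (Cm y (a, !ε) hay * Lm v (y, δ) hvy.symm * Cm y (a, ε) hay) * Lm v (a, ε) hva.symm := by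
  apply rel_ext v a y
  · cases ε <;> cases δ <;>simp [Lm_of, Rm_of, Cm_of, hva, hvy, hay, hva.symm, hvy.symm, hay.symm, mul_assoc]
  · cases ε <;> cases δ <;>simp [Lm_of, Rm_of, Cm_of, hva, hvy, hay, hva.symm, hvy.symm, hay.symm, mul_assoc]
  · cases ε <;> cases δ <;>simp [Lm_of, Rm_of, Cm_of, hva, hvy, hay, hva.symm, hvy.symm, hay.symm, mul_assoc]
  · intro u h1 h2 h3
    simp [Lm_of, Rm_of, Cm_of, h1, h2, h3]

theorem relL2 : Lm v (a, true) hva.symm * Lm a (y, true) hay.symm =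
    ((Cm y (a, false) hay * Lm v (y, false) hvy.symm * Cm y (a, true) hay) *
      Lm a (y, true) hay.symm) * Lm v (a, true) hva.symm := by
  apply rel_ext v a y
  · simp [Lm_of, Rm_of, Cm_of, hva, hvy, hay, hva.symm, hvy.symm, hay.symm, mul_assoc]
  · simp [Lm_of, Rm_of, Cm_of, hva, hvy, hay, hva.symm, hvy.symm, hay.symm, mul_assoc]
  · simp [Lm_of, Rm_of, Cm_of, hva, hvy, hay, hva.symm, hvy.symm, hay.symm, mul_assoc]
  · intro u h1 h2 h3
    simp [Lm_of, Rm_of, Cm_of, h1, h2, h3]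

theorem relL3 : Lm v (a, false) hva.symm * Lm a (y, true) hay.symm =
    (Lm v (y, true) hvy.symm * Lm a (y, true) hay.symm) * Lm v (a, false) hva.symm := by
  apply rel_ext v a y
  · simp [Lm_of, Rm_of, Cm_of, hva, hvy, hay, hva.symm, hvy.symm, hay.symm, mul_assoc]
  · simp [Lm_of, Rm_of, Cm_of, hva, hvy, hay, hva.symm, hvy.symm, hay.symm, mul_assoc]
  · simp [Lm_of, Rm_of, Cm_of, hva, hvy, hay, hva.symm, hvy.symm, hay.symm, mul_assoc]
  · intro u h1 h2 h3
    simp [Lm_of, Rm_of, Cm_of, h1, h2, h3]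

theorem relL4 : Lm v (a, true) hva.symm * Rm a (y, false) hay.symm =
    (Lm v (y, true) hvy.symm * Rm a (y, false) hay.symm) * Lm v (a, true) hva.symm := by
  apply rel_ext v a y
  · simp [Lm_of, Rm_of, Cm_of, hva, hvy, hay, hva.symm, hvy.symm, hay.symm, mul_assoc]
  · simp [Lm_of, Rm_of, Cm_of, hva, hvy, hay, hva.symm, hvy.symm, hay.symm, mul_assoc]
  · simp [Lm_of, Rm_of, Cm_of, hva, hvy, hay, hva.symm, hvy.symm, hay.symm, mul_assoc]
  · intro u h1 h2 h3
    simp [Lm_of, Rm_of, Cm_of, h1, h2, h3]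

theorem relL5 : Lm v (a, false) hva.symm * Rm a (y, false) hay.symm =
    ((Cm y (a, true) hay * Lm v (y, false) hvy.symm * Cm y (a, false) hay) *
      Rm a (y, false) hay.symm) * Lm v (a, false) hva.symm := by
  apply rel_ext v a y
  · simp [Lm_of, Rm_of, Cm_of, hva, hvy, hay, hva.symm, hvy.symm, hay.symm, mul_assoc]
  · simp [Lm_of, Rm_of, Cm_of, hva, hvy, hay, hva.symm, hvy.symm, hay.symm, mul_assoc]
  · simp [Lm_of, Rm_of, Cm_of, hva, hvy, hay, hva.symm, hvy.symm, hay.symm, mul_assoc]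
  · intro u h1 h2 h3
    simp [Lm_of, Rm_of, Cm_of, h1, h2, h3]

theorem relL6 (ε : Bool) : Lm v (a, ε) hva.symm * Cm a (y, true) hay.symm =
    ((Cm y (a, !ε) hay * Lm v (y, false) hvy.symm * Cm y (a, ε) hay) * Lm v (y, true) hvy.symm *
      Cm a (y, true) hay.symm) * Lm v (a, ε) hva.symm := by
  apply rel_ext v a y
  · cases ε <;>simp [Lm_of, Rm_of, Cm_of, hva, hvy, hay, hva.symm, hvy.symm, hay.symm, mul_assoc]
  · cases ε <;>simp [Lm_of, Rm_of, Cm_of, hva, hvy, hay, hva.symm, hvy.symm, hay.symm, mul_assoc]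
  · cases ε <;>simp [Lm_of, Rm_of, Cm_of, hva, hvy, hay, hva.symm, hvy.symm, hay.symm, mul_assoc]
  · intro u h1 h2 h3
    simp [Lm_of, Rm_of, Cm_of, h1, h2, h3]

theorem relL7 (ε : Bool) : Lm v (a, ε) hva.symm * Cm y (v, true) hvy =
    (Cm y (v, true) hvy * Cm y (a, ε) hay) * Lm v (a, ε) hva.symm := by
  apply rel_ext v a y
  · cases ε <;>simp [Lm_of, Rm_of, Cm_of, hva, hvy, hay, hva.symm, hvy.symm, hay.symm, mul_assoc]
  · cases ε <;>simp [Lm_of, Rm_of, Cm_of, hva, hvy, hay, hva.symm, hvy.symm, hay.symm, mul_assoc]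
  · cases ε <;>simp [Lm_of, Rm_of, Cm_of, hva, hvy, hay, hva.symm, hvy.symm, hay.symm, mul_assoc]
  · intro u h1 h2 h3
    simp [Lm_of, Rm_of, Cm_of, h1, h2, h3]

/-! Relations with `s = Cm v (a, ε)` -/

theorem relC1 (ε δ : Bool) : Cm v (a, ε) hva.symm * Cm v (y, δ) hvy.symm =
    (Cm y (a, !ε) hay * Cm v (y, δ) hvy.symm * Cm y (a, ε) hay) * Cm v (a, ε) hva.symm := by
  apply rel_ext v a y
  · cases ε <;> cases δ <;>simp [Lm_of, Rm_of, Cm_of, hva, hvy, hay, hva.symm, hvy.symm, hay.symm, mul_assoc]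
  · cases ε <;> cases δ <;>simp [Lm_of, Rm_of, Cm_of, hva, hvy, hay, hva.symm, hvy.symm, hay.symm, mul_assoc]
  · cases ε <;> cases δ <;>simp [Lm_of, Rm_of, Cm_of, hva, hvy, hay, hva.symm, hvy.symm, hay.symm, mul_assoc]
  · intro u h1 h2 h3
    simp [Lm_of, Rm_of, Cm_of, h1, h2, h3]

theorem relC2 : Cm v (a, true) hva.symm * Lm a (y, true) hay.symm =
    ((Cm y (a, false) hay * Cm v (y, false) hvy.symm * Cm y (a, true) hay) *
      Lm a (y, true) hay.symm) * Cm v (a, true) hva.symm := by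
  apply rel_ext v a y
  · simp [Lm_of, Rm_of, Cm_of, hva, hvy, hay, hva.symm, hvy.symm, hay.symm, mul_assoc]
  · simp [Lm_of, Rm_of, Cm_of, hva, hvy, hay, hva.symm, hvy.symm, hay.symm, mul_assoc]
  · simp [Lm_of, Rm_of, Cm_of, hva, hvy, hay, hva.symm, hvy.symm, hay.symm, mul_assoc]
  · intro u h1 h2 h3
    simp [Lm_of, Rm_of, Cm_of, h1, h2, h3]

theorem relC3 : Cm v (a, false) hva.symm * Lm a (y, true) hay.symm =
    (Cm v (y, true) hvy.symm * Lm a (y, true) hay.symm) * Cm v (a, false) hva.symm := by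
  apply rel_ext v a y
  · simp [Lm_of, Rm_of, Cm_of, hva, hvy, hay, hva.symm, hvy.symm, hay.symm, mul_assoc]
  · simp [Lm_of, Rm_of, Cm_of, hva, hvy, hay, hva.symm, hvy.symm, hay.symm, mul_assoc]
  · simp [Lm_of, Rm_of, Cm_of, hva, hvy, hay, hva.symm, hvy.symm, hay.symm, mul_assoc]
  · intro u h1 h2 h3
    simp [Lm_of, Rm_of, Cm_of, h1, h2, h3]

theorem relC4 : Cm v (a, true) hva.symm * Rm a (y, false) hay.symm =
    (Cm v (y, true) hvy.symm * Rm a (y, false) hay.symm) * Cm v (a, true) hva.symm := by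
  apply rel_ext v a y
  · simp [Lm_of, Rm_of, Cm_of, hva, hvy, hay, hva.symm, hvy.symm, hay.symm, mul_assoc]
  · simp [Lm_of, Rm_of, Cm_of, hva, hvy, hay, hva.symm, hvy.symm, hay.symm, mul_assoc]
  · simp [Lm_of, Rm_of, Cm_of, hva, hvy, hay, hva.symm, hvy.symm, hay.symm, mul_assoc]
  · intro u h1 h2 h3
    simp [Lm_of, Rm_of, Cm_of, h1, h2, h3]

theorem relC5 : Cm v (a, false) hva.symm * Rm a (y, false) hay.symm =
    ((Cm y (a, true) hay * Cm v (y, false) hvy.symm * Cm y (a, false) hay) *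
      Rm a (y, false) hay.symm) * Cm v (a, false) hva.symm := by
  apply rel_ext v a y
  · simp [Lm_of, Rm_of, Cm_of, hva, hvy, hay, hva.symm, hvy.symm, hay.symm, mul_assoc]
  · simp [Lm_of, Rm_of, Cm_of, hva, hvy, hay, hva.symm, hvy.symm, hay.symm, mul_assoc]
  · simp [Lm_of, Rm_of, Cm_of, hva, hvy, hay, hva.symm, hvy.symm, hay.symm, mul_assoc]
  · intro u h1 h2 h3
    simp [Lm_of, Rm_of, Cm_of, h1, h2, h3]

theorem relC6 (ε : Bool) : Cm v (a, ε) hva.symm * Cm a (y, true) hay.symm =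
    ((Cm y (a, !ε) hay * Cm v (y, false) hvy.symm * Cm y (a, ε) hay) * Cm v (y, true) hvy.symm *
      Cm a (y, true) hay.symm) * Cm v (a, ε) hva.symm := by
  apply rel_ext v a y
  · cases ε <;>simp [Lm_of, Rm_of, Cm_of, hva, hvy, hay, hva.symm, hvy.symm, hay.symm, mul_assoc]
  · cases ε <;>simp [Lm_of, Rm_of, Cm_of, hva, hvy, hay, hva.symm, hvy.symm, hay.symm, mul_assoc]
  · cases ε <;>simp [Lm_of, Rm_of, Cm_of, hva, hvy, hay, hva.symm, hvy.symm, hay.symm, mul_assoc]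
  · intro u h1 h2 h3
    simp [Lm_of, Rm_of, Cm_of, h1, h2, h3]

theorem relC7 (ε : Bool) : Cm v (a, ε) hva.symm * Cm y (v, true) hvy =
    (Cm y (a, !ε) hay * Cm y (v, true) hvy * Cm y (a, ε) hay) * Cm v (a, ε) hva.symm := by
  apply rel_ext v a y
  · cases ε <;>simp [Lm_of, Rm_of, Cm_of, hva, hvy, hay, hva.symm, hvy.symm, hay.symm, mul_assoc]
  · cases ε <;>simp [Lm_of, Rm_of, Cm_of, hva, hvy, hay, hva.symm, hvy.symm, hay.symm, mul_assoc]
  · cases ε <;>simp [Lm_of, Rm_of, Cm_of, hva, hvy, hay, hva.symm, hvy.symm, hay.symm, mul_assoc]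
  · intro u h1 h2 h3
    simp [Lm_of, Rm_of, Cm_of, h1, h2, h3]

end rel

end Nielsen

namespace Birman

open FreeGroup hiding map_mul map_inv map_one
open Nielsen

variable {n k l : ℕ}

theorem HG_Lm (i : Fin n) (b : Gen n k l × Bool) (hb : b.1 ≠ gx i) (hy : ∀ j, b.1 ≠ gy j) :
    HG (Lm (gx i) b hb) := by
  obtain ⟨a, ε⟩ := b
  have hva : gx i ≠ a := Ne.symm hb
  have hay : ∀ j, a ≠ gy j := hy
  have hvy : ∀ j, (gx i : Gen n k l) ≠ gy j := fun j => by simp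
  apply HG.of_gen
  · apply SK_cases
    · intro i' j
      by_cases h1 : i = i'
      · subst h1
        exact conj_mem_of (relL1 hva (hvy j) (hay j) ε true)
          (mul_mem (mul_mem (Cy_mem _ _ _) (Lm_mem _ _ _)) (Cy_mem _ _ _))
      · by_cases h2 : a = gx i'
        · subst h2
          cases ε
          · exact conj_mem_of (relL3 hva (hvy j) (hay j)) (mul_mem (Lm_mem _ _ _) (Lm_mem _ _ _))
          · exact conj_mem_of (relL2 hva (hvy j) (hay j))
              (mul_mem (mul_mem (mul_mem (Cy_mem _ _ _) (Lm_mem _ _ _)) (Cy_mem _ _ _))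
                (Lm_mem _ _ _))
        · exact conj_mem_of (LL_comm _ _ (by simpa using h1) h2 (by simp)) (Lm_mem _ _ _)
    · intro i' j
      by_cases h1 : i = i'
      · subst h1
        exact conj_mem_of (LR_comm_same _ _) (Rm_mem _ _ _)
      · by_cases h2 : a = gx i'
        · subst h2
          cases ε
          · exact conj_mem_of (relL5 hva (hvy j) (hay j))
              (mul_mem (mul_mem (mul_mem (Cy_mem _ _ _) (Lm_mem _ _ _)) (Cy_mem _ _ _))
                (Rm_mem _ _ _))
          · exact conj_mem_of (relL4 hva (hvy j) (hay j)) (mul_mem (Lm_mem _ _ _) (Rm_mem _ _ _))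
        · exact conj_mem_of (LR_comm _ _ (by simpa using h1) h2 (by simp)) (Rm_mem _ _ _)
    · intro m j
      by_cases h2 : a = gz m
      · subst h2
        exact conj_mem_of (relL6 hva (hvy j) (hay j) ε)
          (mul_mem (mul_mem (mul_mem (mul_mem (Cy_mem _ _ _) (Lm_mem _ _ _)) (Cy_mem _ _ _))
            (Lm_mem _ _ _)) (Cz_mem _ _ _))
      · exact conj_mem_of (LC_comm _ _ (by simp) h2 (by simp)) (Cz_mem _ _ _)
    · intro j v hv
      by_cases h1 : v = gx i
      · subst h1
        exact conj_mem_of (relL7 hva (hvy j) (hay j) ε) (mul_mem (Cy_mem _ _ _) (Cy_mem _ _ _))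
      · exact conj_mem_of (LC_comm _ _ (by simp) (hay j) h1) (Cy_mem _ _ _)
  · intro j
    simp [Lm_of]
  · intro u hu
    rw [Lm_of]
    split_ifs
    · exact mul_mem (ell_mem_Tg hy) (of_mem_Tg hu)
    · exact of_mem_Tg hu

theorem HG_Cm (m : Fin l) (b : Gen n k l × Bool) (hb : b.1 ≠ gz m) (hy : ∀ j, b.1 ≠ gy j) :
    HG (Cm (gz m) b hb) := by
  obtain ⟨a, ε⟩ := b
  have hva : gz m ≠ a := Ne.symm hb
  have hay : ∀ j, a ≠ gy j := hy
  have hvy : ∀ j, (gz m : Gen n k l) ≠ gy j := fun j => by simp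
  apply HG.of_gen
  · apply SK_cases
    · intro i' j
      by_cases h2 : a = gx i'
      · subst h2
        cases ε
        · exact conj_mem_of (relC3 hva (hvy j) (hay j)) (mul_mem (Cz_mem _ _ _) (Lm_mem _ _ _))
        · exact conj_mem_of (relC2 hva (hvy j) (hay j))
            (mul_mem (mul_mem (mul_mem (Cy_mem _ _ _) (Cz_mem _ _ _)) (Cy_mem _ _ _))
              (Lm_mem _ _ _))
      · exact conj_mem_of (LC_comm _ _ (by simp) (by simp) h2).symm (Lm_mem _ _ _)
    · intro i' j
      by_cases h2 : a = gx i'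
      · subst h2
        cases ε
        · exact conj_mem_of (relC5 hva (hvy j) (hay j))
            (mul_mem (mul_mem (mul_mem (Cy_mem _ _ _) (Cz_mem _ _ _)) (Cy_mem _ _ _))
              (Rm_mem _ _ _))
        · exact conj_mem_of (relC4 hva (hvy j) (hay j)) (mul_mem (Cz_mem _ _ _) (Rm_mem _ _ _))
      · exact conj_mem_of (CR_comm _ _ (by simp) h2 (by simp)) (Rm_mem _ _ _)
    · intro m' j
      by_cases h1 : m = m'
      · subst h1
        exact conj_mem_of (relC1 hva (hvy j) (hay j) ε true)
          (mul_mem (mul_mem (Cy_mem _ _ _) (Cz_mem _ _ _)) (Cy_mem _ _ _))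
      · by_cases h2 : a = gz m'
        · subst h2
          exact conj_mem_of (relC6 hva (hvy j) (hay j) ε)
            (mul_mem (mul_mem (mul_mem (mul_mem (Cy_mem _ _ _) (Cz_mem _ _ _)) (Cy_mem _ _ _))
              (Cz_mem _ _ _)) (Cz_mem _ _ _))
        · exact conj_mem_of (CC_comm _ _ (by simpa using h1) h2 (by simp)) (Cz_mem _ _ _)
    · intro j v hv
      by_cases h1 : v = gz m
      · subst h1
        exact conj_mem_of (relC7 hva (hvy j) (hay j) ε)
          (mul_mem (mul_mem (Cy_mem _ _ _) (Cy_mem _ _ _)) (Cy_mem _ _ _))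
      · exact conj_mem_of (CC_comm _ _ (by simp) (hay j) h1) (Cy_mem _ _ _)
  · intro j
    simp [Cm_of]
  · intro u hu
    rw [Cm_of]
    split_ifs
    · exact mul_mem (mul_mem (ell_mem_Tg hy) (of_mem_Tg hu)) (inv_mem (ell_mem_Tg hy))
    · exact of_mem_Tg hu

/-- Signed permutations of `X`, fixing `Y ∪ Z`. -/
def SP (s : MulAut (FG n k l)) : Prop :=
  (∀ r, s (of (Sum.inr r)) = of (Sum.inr r)) ∧
  ∀ i : Fin n, ∃ (i' : Fin n) (ε : Bool), s (of (Sum.inl i)) = ell (Sum.inl i', ε)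

theorem SP.inl_ne {s : MulAut (FG n k l)} {i i₂ i' i₂' : Fin n} {ε ε₂ : Bool}
    (h : s (of (Sum.inl i)) = ell (Sum.inl i', ε))
    (h₂ : s (of (Sum.inl i₂)) = ell (Sum.inl i₂', ε₂)) (hi : i ≠ i₂) : i' ≠ i₂' := by
  rintro rfl
  apply hi
  have : s (of (Sum.inl i)) = s (of (Sum.inl i₂)) ∨
      s (of (Sum.inl i)) = s (of (Sum.inl i₂))⁻¹ := by
    rw [map_inv, h, h₂]
    cases ε <;> cases ε₂ <;> simp
  have h3 : (Sum.inl i : Gen n k l) = Sum.inl i₂ :=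
    of_eq_of_or (this.imp (fun h => s.injective h) (fun h => s.injective h))
  exact Sum.inl_injective h3

theorem HG_SP {s : MulAut (FG n k l)} (hs : SP s) : HG s := by
  obtain ⟨hr, hx⟩ := hs
  apply HG.of_gen
  · apply SK_cases
    · intro i j
      obtain ⟨i', ε, h⟩ := hx i
      cases ε
      · refine conj_mem_of (t' := Rm (gx i') (gy j, false) (by simp)) ?_ (Rm_mem _ _ _)
        apply aut_ext
        rintro (i₂ | r)
        · by_cases h1 : i₂ = i
          · subst h1
            simp [Lm_self, h, hr, Rm_self]
          · obtain ⟨i₂', ε₂, h₂⟩ := hx i₂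
            have := SP.inl_ne h₂ h h1
            have h4 : (Sum.inl i₂' : Gen n k l) ≠ gx i' := by simpa using this
            simp only [MulAut.mul_apply]
            rw [Lm_ne _ _ (by simpa using h1), h₂, Rm_ell' _ _ _ h4]
        · simp [Lm_ne, Rm_ne, hr]
      · refine conj_mem_of (t' := Lm (gx i') (gy j, true) (by simp)) ?_ (Lm_mem _ _ _)
        apply aut_ext
        rintro (i₂ | r)
        · by_cases h1 : i₂ = i
          · subst h1
            simp [Lm_self, h, hr]
          · obtain ⟨i₂', ε₂, h₂⟩ := hx i₂
            have := SP.inl_ne h₂ h h1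
            have h4 : (Sum.inl i₂' : Gen n k l) ≠ gx i' := by simpa using this
            simp only [MulAut.mul_apply]
            rw [Lm_ne _ _ (by simpa using h1), h₂, Lm_ell' _ _ _ h4]
        · simp [Lm_ne, hr]
    · intro i j
      obtain ⟨i', ε, h⟩ := hx i
      cases ε
      · refine conj_mem_of (t' := Lm (gx i') (gy j, true) (by simp)) ?_ (Lm_mem _ _ _)
        apply aut_ext
        rintro (i₂ | r)
        · by_cases h1 : i₂ = i
          · subst h1
            simp [Lm_self, h, hr, Rm_self]
          · obtain ⟨i₂', ε₂, h₂⟩ := hx i₂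
            have := SP.inl_ne h₂ h h1
            have h4 : (Sum.inl i₂' : Gen n k l) ≠ gx i' := by simpa using this
            simp only [MulAut.mul_apply]
            rw [Rm_ne _ _ (by simpa using h1), h₂, Lm_ell' _ _ _ h4]
        · simp [Lm_ne, Rm_ne, hr]
      · refine conj_mem_of (t' := Rm (gx i') (gy j, false) (by simp)) ?_ (Rm_mem _ _ _)
        apply aut_ext
        rintro (i₂ | r)
        · by_cases h1 : i₂ = i
          · subst h1
            simp [Rm_self, h, hr]
          · obtain ⟨i₂', ε₂, h₂⟩ := hx i₂
            have := SP.inl_ne h₂ h h1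
            have h4 : (Sum.inl i₂' : Gen n k l) ≠ gx i' := by simpa using this
            simp only [MulAut.mul_apply]
            rw [Rm_ne _ _ (by simpa using h1), h₂, Rm_ell' _ _ _ h4]
        · simp [Rm_ne, hr]
    · intro m j
      refine conj_mem_of (t' := Cm (gz m) (gy j, true) (by simp)) ?_ (Cz_mem _ _ _)
      apply aut_ext
      rintro (i₂ | r)
      · obtain ⟨i₂', ε₂, h₂⟩ := hx i₂
        simp only [MulAut.mul_apply]
        rw [Cm_ne _ _ (by simp), h₂, Cm_ell' _ _ _ (by simp)]
      · by_cases h1 : r = Sum.inr m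
        · subst h1
          simp [Cm_self, hr]
        · simp [Cm_ne, h1, hr]
    · intro j v hv
      obtain ⟨c, hc, hcy⟩ : ∃ c : Gen n k l × Bool, s (of v) = ell c ∧ c.1 ≠ gy j := by
        rcases v with i | r
        · obtain ⟨i', ε, h⟩ := hx i
          exact ⟨_, h, by simp⟩
        · exact ⟨(Sum.inr r, true), hr r, hv⟩
      refine conj_mem_of (t' := Cm (gy j) c hcy) ?_ (Cy_mem _ _ _)
      apply aut_ext
      rintro (i₂ | r)
      · obtain ⟨i₂', ε₂, h₂⟩ := hx i₂
        simp only [MulAut.mul_apply]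
        rw [Cm_ne _ _ (by simp), h₂, Cm_ell' _ _ _ (by simp)]
      · by_cases h1 : r = Sum.inl j
        · subst h1
          simp [Cm_self, hr, hc]
        · simp [Cm_ne, h1, hr]
  · intro j
    exact hr _
  · rintro (i | r) hu
    · obtain ⟨i', ε, h⟩ := hx i
      rw [h]
      exact ell_mem_Tg (by simp)
    · rw [hr]
      exact of_mem_Tg hu

theorem SP_Im (i : Fin n) : SP (Im (gx i : Gen n k l)) := by
  constructor
  · intro r
    simp [Im_of]
  · intro i'
    by_cases h : i' = i
    · exact ⟨i', false, by simp [Im_of, h]⟩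
    · exact ⟨i', true, by simp [Im_of, h]⟩

theorem HG_Rm (i : Fin n) (b : Gen n k l × Bool) (hb : b.1 ≠ gx i) (hy : ∀ j, b.1 ≠ gy j) :
    HG (Rm (gx i) b hb) := by
  rw [Rm_eq]
  exact ((HG_SP (SP_Im i)).mul (HG_Lm i (b.1, !b.2) hb hy)).mul (HG_SP (SP_Im i))

/-- The subgroup of automorphisms satisfying `HG` in both directions. -/
def Q (n k l : ℕ) : Subgroup (MulAut (FG n k l)) where
  carrier := {s | s ∈ A n k l ∧ HG s ∧ HG s⁻¹}
  one_mem' := by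
    have : HG (1 : MulAut (FG n k l)) := ⟨by simp, by simp, by simp⟩
    exact ⟨one_mem _, this, by simpa using this⟩
  mul_mem' := by
    rintro s t ⟨h1, h2, h3⟩ ⟨k1, k2, k3⟩
    exact ⟨mul_mem h1 k1, h2.mul k2, by rw [mul_inv_rev]; exact k3.mul h3⟩
  inv_mem' := by
    rintro s ⟨h1, h2, h3⟩
    exact ⟨inv_mem h1, h3, by rwa [inv_inv]⟩

/-- The subgroup `Lg * Q`. -/
def GG (n k l : ℕ) : Subgroup (MulAut (FG n k l)) where
  carrier := {s | ∃ t ∈ Lg n k l, ∃ q ∈ Q n k l, s = t * q}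
  one_mem' := ⟨1, one_mem _, 1, one_mem _, by simp⟩
  mul_mem' := by
    rintro _ _ ⟨t, ht, q, hq, rfl⟩ ⟨t', ht', q', hq', rfl⟩
    exact ⟨t * (q * t' * q⁻¹), mul_mem ht (hq.2.1.a _ ht'), q * q', mul_mem hq hq', by group⟩
  inv_mem' := by
    rintro _ ⟨t, ht, q, hq, rfl⟩
    refine ⟨q⁻¹ * t⁻¹ * q⁻¹⁻¹, hq.2.2.a _ (inv_mem ht), q⁻¹, inv_mem hq, by group⟩

theorem Lg_le_GG : Lg n k l ≤ GG n k l := fun t ht => ⟨t, ht, 1, one_mem _, by simp⟩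
theorem Q_le_GG : Q n k l ≤ GG n k l := fun t ht => ⟨1, one_mem _, t, ht, by simp⟩

theorem A_of_fix {s : MulAut (FG n k l)} (h : ∀ r, s (of (Sum.inr r)) = of (Sum.inr r)) :
    s ∈ A n k l := fun r => by rw [h]

theorem Cm_mem_A (r : Fin k ⊕ Fin l) (b : Gen n k l × Bool) (hb : b.1 ≠ Sum.inr r) :
    Cm (Sum.inr r) b hb ∈ A n k l := by
  intro r'
  rw [Cm_of]
  split_ifs
  · exact isConj_iff.2 ⟨ell b, rfl⟩
  · exact IsConj.refl _

theorem Lm_mem_GG (i : Fin n) (b : Gen n k l × Bool) (hb : b.1 ≠ gx i) :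
    Lm (gx i) b hb ∈ GG n k l := by
  by_cases hy : ∀ j, b.1 ≠ gy j
  · exact Q_le_GG ⟨A_of_fix fun r => Lm_ne _ _ (by simp), HG_Lm i b hb hy, by
      rw [Lm_inv]; exact HG_Lm i (b.1, !b.2) hb hy⟩
  · push Not at hy
    obtain ⟨j, hj⟩ := hy
    obtain ⟨a, ε⟩ := b
    obtain rfl : a = gy j := hj
    exact Lg_le_GG (Lm_mem _ _ _)

theorem Rm_mem_GG (i : Fin n) (b : Gen n k l × Bool) (hb : b.1 ≠ gx i) :
    Rm (gx i) b hb ∈ GG n k l := by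
  by_cases hy : ∀ j, b.1 ≠ gy j
  · exact Q_le_GG ⟨A_of_fix fun r => Rm_ne _ _ (by simp), HG_Rm i b hb hy, by
      rw [Rm_inv]; exact HG_Rm i (b.1, !b.2) hb hy⟩
  · push Not at hy
    obtain ⟨j, hj⟩ := hy
    obtain ⟨a, ε⟩ := b
    obtain rfl : a = gy j := hj
    exact Lg_le_GG (Rm_mem _ _ _)

theorem Cm_mem_GG (r : Fin k ⊕ Fin l) (b : Gen n k l × Bool) (hb : b.1 ≠ Sum.inr r) :
    Cm (Sum.inr r) b hb ∈ GG n k l := by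
  rcases r with j | m
  · exact Lg_le_GG (Cy_mem _ _ _)
  by_cases hy : ∀ j, b.1 ≠ gy j
  · exact Q_le_GG ⟨Cm_mem_A _ _ _, HG_Cm m b hb hy, by
      rw [Cm_inv]; exact HG_Cm m (b.1, !b.2) hb hy⟩
  · push Not at hy
    obtain ⟨j, hj⟩ := hy
    obtain ⟨a, ε⟩ := b
    obtain rfl : a = gy j := hj
    exact Lg_le_GG (Cz_mem _ _ _)

theorem SP_mem_GG {s : MulAut (FG n k l)} (h : SP s) (h' : SP s⁻¹) : s ∈ GG n k l :=
  Q_le_GG ⟨A_of_fix h.1, HG_SP h, HG_SP h'⟩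

end Birman

namespace Nielsen

open FreeGroup hiding map_mul map_inv map_one

variable {α : Type*} [DecidableEq α]

theorem mlt_inv {B : ℕ} {e : α × Bool → ℕ} {u v : FreeGroup α} :
    mlt B e u⁻¹ v⁻¹ ↔ mlt B e u v := by
  simp [mlt, rk_inv]

/-- The complexity of an automorphism. -/
def meas [Fintype α] (B : ℕ) (e : α × Bool → ℕ) (g : MulAut (FreeGroup α)) : ℕ ×ₗ ℕ :=
  toLex (∑ a, (g (of a)).norm, ∑ a, rk B e (g (of a)))

theorem meas_lt [Fintype α] {B : ℕ} {e : α × Bool → ℕ} {f g : MulAut (FreeGroup α)} (a : α)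
    (h : mlt B e (g (of a)) (f (of a))) (h' : ∀ u, u ≠ a → g (of u) = f (of u)) :
    meas B e g < meas B e f := by
  rw [meas, meas, Prod.Lex.toLex_lt_toLex]
  have e1 : ∀ F : FreeGroup α → ℕ, ∑ u ∈ Finset.univ.erase a, F (g (of u)) =
      ∑ u ∈ Finset.univ.erase a, F (f (of u)) := by
    intro F
    apply Finset.sum_congr rfl
    intro u hu
    rw [h' u (Finset.ne_of_mem_erase hu)]
  have s1 := Finset.add_sum_erase Finset.univ (fun u => (g (of u)).norm) (Finset.mem_univ a)
  have s2 := Finset.add_sum_erase Finset.univ (fun u => (f (of u)).norm) (Finset.mem_univ a)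
  have s3 := Finset.add_sum_erase Finset.univ (fun u => rk B e (g (of u))) (Finset.mem_univ a)
  have s4 := Finset.add_sum_erase Finset.univ (fun u => rk B e (f (of u))) (Finset.mem_univ a)
  have e2 := e1 FreeGroup.norm
  have e3 := e1 (rk B e)
  rcases h with h | ⟨h, h2⟩
  · left
    omega
  · right
    constructor <;> simp only <;> omega

theorem lw_eq (f : MulAut (FreeGroup α)) (b : α × Bool) :
    lw (fun u => f (of u)) b = f (ell b) := by
  rcases b with ⟨b, _ | _⟩ <;> simp [lw]

end Nielsen

namespace Birman

open FreeGroup hiding map_mul map_inv map_one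
open Nielsen

variable {n k l : ℕ}

theorem mem_fixProj {s : MulAut (FG n k l)}
    (h : ∀ u, proj n k l (s (of u)) = proj n k l (of u)) : s ∈ fixProj n k l := by
  have : (proj n k l).comp s.toMonoidHom = proj n k l := FreeGroup.ext_hom _ _ h
  intro w
  exact DFunLike.congr_fun this w

theorem proj_y (j : Fin k) : proj n k l (of (gy j)) = 1 := by simp [proj]

theorem SK_subset_K : ∀ t ∈ SK n k l, t ∈ K n k l := by
  apply SK_cases
  · intro i j
    refine ⟨A_of_fix fun r => Lm_ne _ _ (by simp), mem_fixProj fun u => ?_⟩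
    rw [Lm_of]
    split_ifs <;> simp [proj_y]
  · intro i j
    refine ⟨A_of_fix fun r => Rm_ne _ _ (by simp), mem_fixProj fun u => ?_⟩
    rw [Rm_of]
    split_ifs <;> simp [proj_y]
  · intro m j
    refine ⟨Cm_mem_A _ _ _, mem_fixProj fun u => ?_⟩
    rw [Cm_of]
    split_ifs <;> simp [proj_y]
  · intro j v hv
    refine ⟨Cm_mem_A _ _ _, mem_fixProj fun u => ?_⟩
    rw [Cm_of]
    split_ifs with h
    · simp [h, proj_y]
    · rfl

theorem Lg_le_K : Lg n k l ≤ K n k l := (Subgroup.closure_le _).2 SK_subset_K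

theorem GG_le_A : GG n k l ≤ A n k l := by
  rintro _ ⟨t, ht, q, hq, rfl⟩
  exact mul_mem (Lg_le_K ht).1 hq.1

theorem fix_of_letter {g : MulAut (FG n k l)} (hg : g ∈ A n k l) (r : Fin k ⊕ Fin l)
    {b : Gen n k l × Bool} (hb : g (of (Sum.inr r)) = ell b) :
    g (of (Sum.inr r)) = of (Sum.inr r) := by
  obtain ⟨c, hc⟩ := conj_word (hg r)
  rw [hb, toWord_ell] at hc
  have hl := congrArg List.length hc
  simp at hl
  have : c.toWord = [] := by
    apply List.eq_nil_of_length_eq_zero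
    omega
  rw [this] at hc
  simp at hc
  rw [hb, hc]
  rfl

/-- An automorphism all of whose inverse images of letters are letters is a signed permutation. -/
theorem SP_of_letters {g : MulAut (FG n k l)} (hg : g ∈ A n k l)
    (h : ∀ u, ∃ b, g (of u) = ell b) : SP g := by
  have h1 : ∀ r, g (of (Sum.inr r)) = of (Sum.inr r) := fun r => by
    obtain ⟨b, hb⟩ := h (Sum.inr r)
    exact fix_of_letter hg r hb
  refine ⟨h1, fun i => ?_⟩
  obtain ⟨⟨b, ε⟩, hb⟩ := h (Sum.inl i)
  rcases b with i' | r
  · exact ⟨i', ε, hb⟩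
  · exfalso
    have h2 : g (of (Sum.inl i)) = g (of (Sum.inr r)) ∨
        g (of (Sum.inl i)) = g (of (Sum.inr r))⁻¹ := by
      rw [map_inv, h1, hb]
      cases ε <;> simp
    have h3 : (Sum.inl i : Gen n k l) = Sum.inr r :=
      of_eq_of_or (h2.imp (fun h => g.injective h) (fun h => g.injective h))
    simp at h3

theorem letters_inv {g : MulAut (FG n k l)} (h : ∀ u, ∃ b, g (of u) = ell b) :
    ∀ u, ∃ b, g⁻¹ (of u) = ell b := by
  have h' : ∀ c : Gen n k l × Bool, ∃ b, g (ell c) = ell b := by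
    rintro ⟨u, ε⟩
    obtain ⟨b, hb⟩ := h u
    cases ε
    · exact ⟨(b.1, !b.2), by rw [ell_not, ← hb]; simp⟩
    · exact ⟨b, hb⟩
  choose F hF using h'
  have ell_inj : Function.Injective (ell : Gen n k l × Bool → FG n k l) := by
    intro b c hbc
    have := congrArg toWord hbc
    simpa [toWord_ell] using this
  have hinj : Function.Injective F := by
    intro b c hbc
    apply ell_inj
    apply g.injective
    rw [hF, hF, hbc]
  have hsurj := Finite.surjective_of_injective hinj
  intro u
  obtain ⟨b, hb⟩ := hsurj (u, true)
  refine ⟨b, ?_⟩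
  have h2 := hF b
  rw [hb, ell_true] at h2
  rw [← h2]
  simp

theorem A_le_GG : A n k l ≤ GG n k l := by
  intro f hf
  let E := Fintype.equivFin (Gen n k l × Bool)
  let e : Gen n k l × Bool → ℕ := fun a => (E a : ℕ)
  let B : ℕ := Fintype.card (Gen n k l × Bool) + 2
  have hB : 1 < B := by simp [B]
  have he : Function.Injective e := fun a b h => E.injective (Fin.ext h)
  have heB : ∀ a, e a < B := fun a => by
    have := (E a).isLt
    simp only [e, B]
    omega
  obtain ⟨s, hs, hmin⟩ : ∃ s ∈ GG n k l, ∀ t ∈ GG n k l, ¬ meas B e (f * t) < meas B e (f * s) := by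
    let T : Set (ℕ ×ₗ ℕ) := (fun t => meas B e (f * t)) '' (GG n k l : Set (MulAut (FG n k l)))
    have hT : T.Nonempty := ⟨_, 1, one_mem _, rfl⟩
    obtain ⟨m, ⟨s, hs, hsm⟩, hm⟩ := wellFounded_lt.has_min T hT
    refine ⟨s, hs, fun t ht => ?_⟩
    have := hm _ ⟨t, ht, rfl⟩
    rw [← hsm] at this
    exact this
  set g := f * s with hgdef
  have hgA : g ∈ A n k l := mul_mem hf (GG_le_A hs)
  have hmin' : ∀ t ∈ GG n k l, ¬ meas B e (g * t) < meas B e g := by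
    intro t ht
    have := hmin (s * t) (mul_mem hs ht)
    rwa [← mul_assoc] at this
  have H : Irr B e (fun a : Gen n k l => ∃ r, a = Sum.inr r) (fun u => g (of u)) := by
    constructor
    · rintro ⟨a, ε⟩ ha b hb hlt
      rcases a with i | r
      swap
      · exact ha ⟨r, rfl⟩
      have hb' : b.1 ≠ gx i := hb
      rw [lw_eq, lw_eq] at hlt
      cases ε
      · refine hmin' _ (Rm_mem_GG i (b.1, !b.2) hb') (meas_lt (gx i) ?_ fun u hu => ?_)
        · rw [MulAut.mul_apply, Rm_self, ell_not, ← mlt_inv]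
          simpa using hlt
        · rw [MulAut.mul_apply, Rm_ne _ _ hu]
      · refine hmin' _ (Lm_mem_GG i b hb') (meas_lt (gx i) ?_ fun u hu => ?_)
        · rw [MulAut.mul_apply, Lm_self]
          simpa using hlt
        · rw [MulAut.mul_apply, Lm_ne _ _ hu]
    · rintro ⟨a, ε⟩ ha b hb hlt
      obtain ⟨r, hr⟩ := ha
      obtain rfl : a = Sum.inr r := hr
      have hb' : b.1 ≠ Sum.inr r := hb
      rw [lw_eq, lw_eq] at hlt
      refine hmin' _ (Cm_mem_GG r b hb') (meas_lt (Sum.inr r) ?_ fun u hu => ?_)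
      · rw [MulAut.mul_apply, Cm_self]
        cases ε
        · rw [← mlt_inv]
          simpa [mul_assoc] using hlt
        · simpa using hlt
      · rw [MulAut.mul_apply, Cm_ne _ _ hu]
    · rintro a ⟨r, rfl⟩
      exact hgA r
    · intro a h
      have : g (of a) = g 1 := by rw [map_one]; exact h
      exact FreeGroup.of_ne_one a (g.injective this)
  have hlift : ∀ w, FreeGroup.lift (fun u => g (of u)) w = g w := by
    intro w
    have : FreeGroup.lift (fun u => g (of u)) = g.toMonoidHom :=
      FreeGroup.ext_hom _ _ (fun u => by simp)
    exact DFunLike.congr_fun this w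
  have hle : ∀ w, w.norm ≤ (g w).norm := fun w => by
    rw [← hlift]
    exact H.norm_le hB he heB w
  have hlet : ∀ u, ∃ b, g⁻¹ (of u) = ell b := by
    intro u
    apply eq_ell_of_norm
    have h1 := hle (g⁻¹ (of u))
    rw [MulAut.apply_inv_self, FreeGroup.norm_of] at h1
    have h2 : (g⁻¹ (of u)).norm ≠ 0 := by
      rw [Ne, FreeGroup.norm_eq_zero]
      intro h
      have : g⁻¹ (of u) = g⁻¹ 1 := by rw [map_one]; exact h
      exact FreeGroup.of_ne_one u ((g⁻¹ : MulAut (FG n k l)).injective this)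
    omega
  have hlet' := letters_inv hlet
  rw [inv_inv] at hlet'
  have hg : g ∈ GG n k l := SP_mem_GG (SP_of_letters hgA hlet') (SP_of_letters (inv_mem hgA) hlet)
  have : f = g * s⁻¹ := by rw [hgdef]; group
  rw [this]
  exact mul_mem hg (inv_mem hs)

/-- The inclusion of `F_{n,0,l}` in `F_{n,k,l}`. -/
def incl (n k l : ℕ) : FG n 0 l →* FG n k l :=
  FreeGroup.lift fun g => match g with
    | Sum.inl i => of (gx i)
    | Sum.inr (Sum.inl _) => 1
    | Sum.inr (Sum.inr m) => of (gz m)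

theorem incl_proj {w : FG n k l} (hw : w ∈ Tg n k l) : incl n k l (proj n k l w) = w := by
  have : Tg n k l ≤ ((incl n k l).comp (proj n k l)).eqLocus (MonoidHom.id _) := by
    rw [Tg, Subgroup.closure_le]
    rintro _ ⟨u, hu, rfl⟩
    rcases u with i | j | m
    · simp [MonoidHom.eqLocus, incl, proj]
    · exact absurd rfl (hu j)
    · simp [MonoidHom.eqLocus, incl, proj]
  exact this hw

theorem K_le_Lg : K n k l ≤ Lg n k l := by
  intro f hf
  obtain ⟨t, ht, q, hq, rfl⟩ := A_le_GG hf.1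
  have hqK : q ∈ K n k l := (Subgroup.mul_mem_cancel_left _ (Lg_le_K ht)).1 hf
  have hq1 : q = 1 := by
    apply aut_ext
    intro u
    rw [MulAut.one_apply]
    by_cases hu : ∀ j, u ≠ gy j
    · have h1 := of_mem_Tg hu
      have h2 := hq.2.1.c _ h1
      have h3 : proj n k l (q (of u)) = proj n k l (of u) := hqK.2 _
      rw [← incl_proj h2, h3, incl_proj h1]
    · push Not at hu
      obtain ⟨j, rfl⟩ := hu
      exact hq.2.1.b j
  rw [hq1, mul_one]
  exact ht

end Birman

namespace Birman

/-- **Theorem A.**  The group `K_{n,k,l}` is generated by the finite set `S_K`. -/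
theorem K_generated_by_SK (n k l : ℕ) :
    Subgroup.closure (SK n k l) = K n k l := by
  exact le_antisymm Lg_le_K K_le_Lg

end Birman
end

section
/- If k ≥ 1 and n + l ≥ 2, then the second group homology H_2(K_{n,k,l}; ℚ) with trivial rational coefficients is infinite-dimensional as a ℚ-vector space. -/
namespace GroupH2

variable (G : Type*) [Group G]

/-- Degree-2 differential of the inhomogeneous bar complex of `G` with trivial `ℚ`
coefficients: `d₂(g, h) = [h] - [g h] + [g]`. -/
noncomputable def d2 : ((G × G) →₀ ℚ) →ₗ[ℚ] (G →₀ ℚ) :=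
  Finsupp.lift (G →₀ ℚ) ℚ (G × G) fun p =>
    Finsupp.single p.2 (1 : ℚ) - Finsupp.single (p.1 * p.2) 1 + Finsupp.single p.1 1

/-- Degree-3 differential of the inhomogeneous bar complex of `G` with trivial `ℚ`
coefficients: `d₃(g, h, j) = [h, j] - [g h, j] + [g, h j] - [g, h]`. -/
noncomputable def d3 : ((G × G × G) →₀ ℚ) →ₗ[ℚ] ((G × G) →₀ ℚ) :=
  Finsupp.lift ((G × G) →₀ ℚ) ℚ (G × G × G) fun t =>
    Finsupp.single (t.2.1, t.2.2) (1 : ℚ) - Finsupp.single (t.1 * t.2.1, t.2.2) 1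
      + Finsupp.single (t.1, t.2.1 * t.2.2) 1 - Finsupp.single (t.1, t.2.1) 1

/-- 2-cycles. -/
noncomputable def Z2 : Submodule ℚ ((G × G) →₀ ℚ) := LinearMap.ker (d2 G)

/-- 2-boundaries, as a submodule of the 2-cycles. -/
noncomputable def B2 : Submodule ℚ ↥(Z2 G) :=
  Submodule.comap (Z2 G).subtype (LinearMap.range (d3 G))

/-- The second group homology `H₂(G; ℚ)` with trivial coefficients, defined via the
inhomogeneous bar resolution as cycles modulo boundaries. -/
noncomputable def H2 := ↥(Z2 G) ⧸ B2 G

noncomputable instance : AddCommGroup (H2 G) := by unfold H2; infer_instance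
noncomputable instance : Module ℚ (H2 G) := by unfold H2; infer_instance

end GroupH2

namespace Birman

open LaurentPolynomial

/-- The Laurent polynomial ring used as a coefficient module. -/
abbrev LR := LaurentPolynomial ℚ

/-- The affine group `R ⋊ ℤ`, with `ℤ` acting through powers of `T`. -/
@[ext] structure Aff where
  deg : ℤ
  val : LR

namespace Aff

noncomputable instance : Mul Aff := ⟨fun a b => ⟨a.deg + b.deg, a.val + T a.deg * b.val⟩⟩
noncomputable instance : One Aff := ⟨⟨0, 0⟩⟩
noncomputable instance : Inv Aff := ⟨fun a => ⟨-a.deg, -(T (-a.deg) * a.val)⟩⟩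

@[simp] lemma mul_deg (a b : Aff) : (a * b).deg = a.deg + b.deg := rfl
@[simp] lemma mul_val (a b : Aff) : (a * b).val = a.val + T a.deg * b.val := rfl
@[simp] lemma one_deg : (1 : Aff).deg = 0 := rfl
@[simp] lemma one_val : (1 : Aff).val = 0 := rfl
@[simp] lemma inv_deg (a : Aff) : (a⁻¹).deg = -a.deg := rfl
@[simp] lemma inv_val (a : Aff) : (a⁻¹).val = -(T (-a.deg) * a.val) := rfl

noncomputable instance : Group Aff := Group.ofLeftAxioms
  (by intro a b c
      ext1
      · simp [add_assoc]
      · simp only [mul_val, mul_deg, T_add]; ring)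
  (by intro a
      ext1 <;> simp)
  (by intro a
      ext1 <;> simp)

end Aff

/-- Values of the Fox derivative homomorphism on generators. -/
noncomputable def foxGen {n k l : ℕ} (j₀ : Fin k) : Gen n k l → Aff
  | Sum.inl _ => ⟨1, 0⟩
  | Sum.inr (Sum.inl j) => ⟨0, if j = j₀ then 1 else 0⟩
  | Sum.inr (Sum.inr _) => ⟨1, 0⟩

/-- Degree together with Fox derivative with respect to `y_{j₀}`. -/
noncomputable def fox {n k l : ℕ} (j₀ : Fin k) : FG n k l →* Aff :=
  FreeGroup.lift (foxGen j₀)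

/-- The section of `proj`. -/
def sect (n k l : ℕ) : FG n 0 l →* FG n k l :=
  FreeGroup.lift fun g => match g with
    | Sum.inl i => FreeGroup.of (Sum.inl i)
    | Sum.inr (Sum.inl j) => j.elim0
    | Sum.inr (Sum.inr m) => FreeGroup.of (Sum.inr (Sum.inr m))

/-- The degree on `FG n 0 l`. -/
def degHom0 (n l : ℕ) : FG n 0 l →* Multiplicative ℤ :=
  FreeGroup.lift fun _ => Multiplicative.ofAdd 1

variable {n k l : ℕ} (j₀ : Fin k)

lemma fox_deg_eq (u : FG n k l) :
    (fox j₀ u).deg = (degHom0 n l (proj n k l u)).toAdd := by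
  let d : Aff →* Multiplicative ℤ :=
    { toFun := fun a => Multiplicative.ofAdd a.deg
      map_one' := rfl
      map_mul' := fun _ _ => rfl }
  have h : d.comp (fox j₀) = (degHom0 n l).comp (proj n k l) := by
    apply FreeGroup.ext_hom
    rintro (i | j | m) <;> simp [d, fox, foxGen, degHom0, proj]
  exact congrArg Multiplicative.toAdd (DFunLike.congr_fun h u)

lemma fox_deg_K {f : MulAut (FG n k l)} (hf : f ∈ K n k l) (u : FG n k l) :
    (fox j₀ (f u)).deg = (fox j₀ u).deg := by
  rw [fox_deg_eq, fox_deg_eq, hf.2 u]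

/-- The Fox derivative. -/
noncomputable def D (u : FG n k l) : LR := (fox j₀ u).val

lemma D_y {f : MulAut (FG n k l)} (hf : f ∈ K n k l) (j : Fin k) :
    ∃ m : ℤ, D j₀ (f (FreeGroup.of (Sum.inr (Sum.inl j)))) =
      T m * (if j = j₀ then 1 else 0) := by
  obtain ⟨c, hc⟩ := isConj_iff.1 (hf.1 (Sum.inl j))
  refine ⟨(fox j₀ c).deg, ?_⟩
  rw [← hc]
  simp only [D, map_mul, map_inv, Aff.mul_val, Aff.mul_deg, Aff.inv_val]
  have : fox j₀ (FreeGroup.of (Sum.inr (Sum.inl j)) : FG n k l) =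
    ⟨0, if j = j₀ then 1 else 0⟩ := by simp [fox, foxGen]
  rw [this]
  simp only [add_zero, mul_neg, ← mul_assoc, ← T_add, add_neg_cancel, T_zero, one_mul]
  ring

/-- The multiplier of `f`. -/
noncomputable def tm (f : MulAut (FG n k l)) : LR :=
  D j₀ (f (FreeGroup.of (Sum.inr (Sum.inl j₀))))

lemma tm_eq {f : MulAut (FG n k l)} (hf : f ∈ K n k l) : ∃ m : ℤ, tm j₀ f = T m := by
  obtain ⟨m, hm⟩ := D_y j₀ hf j₀
  exact ⟨m, by simpa [tm] using hm⟩

lemma D_comp {f h : MulAut (FG n k l)} (hf : f ∈ K n k l) (hh : h ∈ K n k l)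
    (u : FG n k l) :
    D j₀ (f (h u)) - tm j₀ f * D j₀ (h u) = D j₀ (f u) - tm j₀ f * D j₀ u := by
  let ψ : FG n k l →* Aff :=
    { toFun := fun u => ⟨(fox j₀ u).deg, D j₀ (f u) - tm j₀ f * D j₀ u⟩
      map_one' := by ext1 <;> simp [D]
      map_mul' := by
        intro u v
        ext1
        · simp
        · simp only [D, map_mul, Aff.mul_val, fox_deg_K j₀ hf]
          ring }
  have hψ : ψ = (ψ.comp (sect n k l)).comp (proj n k l) := by
    apply FreeGroup.ext_hom
    rintro (i | j | m)
    · simp [proj, sect]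
    · simp only [MonoidHom.comp_apply]
      have : proj n k l (FreeGroup.of (Sum.inr (Sum.inl j))) = 1 := by simp [proj]
      rw [this, map_one, map_one]
      have h2 : fox j₀ (FreeGroup.of (Sum.inr (Sum.inl j)) : FG n k l) =
        ⟨0, if j = j₀ then 1 else 0⟩ := by simp [fox, foxGen]
      ext1
      · change (fox j₀ (FreeGroup.of (Sum.inr (Sum.inl j)) : FG n k l)).deg = 0
        rw [h2]
      · change D j₀ (f (FreeGroup.of (Sum.inr (Sum.inl j)))) - tm j₀ f *
          (fox j₀ (FreeGroup.of (Sum.inr (Sum.inl j)) : FG n k l)).val = 0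
        rw [h2]
        by_cases hj : j = j₀
        · subst hj; simp [tm]
        · obtain ⟨m, hm⟩ := D_y j₀ hf j
          rw [hm]; simp [hj]
    · simp [proj, sect]
  have key : ψ (h u) = ψ u := by
    rw [hψ]
    simp only [MonoidHom.comp_apply]
    rw [hh.2 u]
  exact congrArg Aff.val key

lemma tm_mul {f h : MulAut (FG n k l)} (hf : f ∈ K n k l) (hh : h ∈ K n k l) :
    tm j₀ (f * h) = tm j₀ f * tm j₀ h := by
  have := D_comp j₀ hf hh (FreeGroup.of (Sum.inr (Sum.inl j₀)))
  have h1 : D j₀ (FreeGroup.of (Sum.inr (Sum.inl j₀)) : FG n k l) = 1 := by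
    simp [D, fox, foxGen]
  rw [h1] at this
  simp only [tm, MulAut.mul_apply] at this ⊢
  linear_combination this

/-- The generators outside `Y`. -/
def vg : Fin n ⊕ Fin l → Gen n k l
  | Sum.inl i => Sum.inl i
  | Sum.inr m => Sum.inr (Sum.inr m)

lemma vg_inj : Function.Injective (vg : Fin n ⊕ Fin l → Gen n k l) := by
  rintro (i | i) (j | j) h <;> simp_all [vg]

lemma vg_ne_y (v : Fin n ⊕ Fin l) (j : Fin k) :
    (vg v : Gen n k l) ≠ Sum.inr (Sum.inl j) := by
  rcases v with i | i <;> simp [vg]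

lemma fox_vg (v : Fin n ⊕ Fin l) :
    fox j₀ (FreeGroup.of (vg v) : FG n k l) = ⟨1, 0⟩ := by
  rcases v with i | i <;> simp [fox, foxGen, vg]

lemma D_mul {f h : MulAut (FG n k l)} (hf : f ∈ K n k l) (hh : h ∈ K n k l)
    (v : Fin n ⊕ Fin l) :
    D j₀ ((f * h) (FreeGroup.of (vg v))) =
      D j₀ (f (FreeGroup.of (vg v))) + tm j₀ f * D j₀ (h (FreeGroup.of (vg v))) := by
  have := D_comp j₀ hf hh (FreeGroup.of (vg v))
  have h1 : D j₀ (FreeGroup.of (vg v) : FG n k l) = 0 := by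
    simp [D, fox_vg]
  rw [h1] at this
  simp only [MulAut.mul_apply] at this ⊢
  linear_combination this

/-- The cocycle. -/
noncomputable def coc (v₁ v₂ : Fin n ⊕ Fin l) (p : K n k l × K n k l) : LR :=
  invert (D j₀ (p.1.1 (FreeGroup.of (vg v₁)))) * tm j₀ p.1.1 *
    D j₀ (p.2.1 (FreeGroup.of (vg v₂)))

lemma coc_cocycle (v₁ v₂ : Fin n ⊕ Fin l) (a b c : K n k l) :
    coc j₀ v₁ v₂ (b, c) - coc j₀ v₁ v₂ (a * b, c) + coc j₀ v₁ v₂ (a, b * c)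
      - coc j₀ v₁ v₂ (a, b) = 0 := by
  simp only [coc, Subgroup.coe_mul, tm_mul j₀ a.2 b.2, D_mul j₀ a.2 b.2, D_mul j₀ b.2 c.2,
    map_add, map_mul]
  obtain ⟨m, hm⟩ := tm_eq j₀ a.2
  have h1 : invert (tm j₀ a.1) * tm j₀ a.1 = 1 := by
    rw [hm, invert_T, ← T_add, neg_add_cancel, T_zero]
  linear_combination (-(invert (D j₀ (b.1 (FreeGroup.of (vg v₁)))) * tm j₀ b.1 *
    D j₀ (c.1 (FreeGroup.of (vg v₂))))) * h1

/-- Partial conjugation of a generator as an endomorphism. -/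
def pconjHom {ι : Type*} [DecidableEq ι] (v : ι) (w : FreeGroup ι) :
    FreeGroup ι →* FreeGroup ι :=
  FreeGroup.lift fun u => if u = v then w * FreeGroup.of v * w⁻¹ else FreeGroup.of u

lemma pconjHom_of {ι : Type*} [DecidableEq ι] (v : ι) (w : FreeGroup ι) (u : ι) :
    pconjHom v w (FreeGroup.of u) =
      if u = v then w * FreeGroup.of v * w⁻¹ else FreeGroup.of u := by
  simp [pconjHom]

lemma pconj_inv {ι : Type*} [DecidableEq ι] (v : ι) (w : FreeGroup ι)
    (hw : pconjHom v w⁻¹ w = w) : (pconjHom v w⁻¹).comp (pconjHom v w) = MonoidHom.id _ := by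
  apply FreeGroup.ext_hom
  intro u
  by_cases h : u = v
  · subst h
    simp only [MonoidHom.comp_apply, pconjHom_of, if_true, map_mul, map_inv, hw]
    simp [mul_assoc]
  · simp [MonoidHom.comp_apply, pconjHom_of, h]

/-- Partial conjugation as an automorphism. -/
def pconj {ι : Type*} [DecidableEq ι] (v : ι) (w : FreeGroup ι)
    (hw : ∀ w', pconjHom v w' w = w) : MulAut (FreeGroup ι) :=
  MonoidHom.toMulEquiv (pconjHom v w) (pconjHom v w⁻¹) (pconj_inv v w (hw _))
    (by
      have := pconj_inv v w⁻¹ (by rw [map_inv, hw])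
      rwa [inv_inv] at this)

/-- The word `v₁^p y v₁^{-p}`. -/
def wd (v₁ : Fin n ⊕ Fin l) (p : ℤ) : FG n k l :=
  FreeGroup.of (vg v₁) ^ p * FreeGroup.of (Sum.inr (Sum.inl j₀)) * (FreeGroup.of (vg v₁) ^ p)⁻¹

lemma wd_fix {v₁ v₂ : Fin n ⊕ Fin l} (hv : v₁ ≠ v₂) (p : ℤ) (w' : FG n k l) :
    pconjHom (vg v₂) w' (wd j₀ v₁ p) = wd j₀ v₁ p := by
  have h1 : (vg v₁ : Gen n k l) ≠ vg v₂ := fun h => hv (vg_inj h)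
  have h2 := (vg_ne_y (k := k) v₂ j₀).symm
  simp only [wd, map_mul, map_inv, map_zpow, pconjHom_of, h1, h2, if_false]

/-- The element `b_p`. -/
def bAut {v₁ v₂ : Fin n ⊕ Fin l} (hv : v₁ ≠ v₂) (p : ℤ) : MulAut (FG n k l) :=
  pconj (vg v₂) (wd j₀ v₁ p) (wd_fix j₀ hv p)

lemma bAut_apply {v₁ v₂ : Fin n ⊕ Fin l} (hv : v₁ ≠ v₂) (p : ℤ) (u : FG n k l) :
    bAut j₀ hv p u = pconjHom (vg v₂) (wd j₀ v₁ p) u := rfl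

lemma bAut_mem {v₁ v₂ : Fin n ⊕ Fin l} (hv : v₁ ≠ v₂) (p : ℤ) :
    bAut j₀ hv p ∈ K n k l := by
  constructor
  · intro s
    rw [bAut_apply, pconjHom_of]
    split_ifs with h
    · rw [h]
      exact isConj_iff.2 ⟨_, rfl⟩
    · exact IsConj.refl _
  · intro w
    have hw : proj n k l (wd j₀ v₁ p) = 1 := by
      simp [wd, proj]
    have : (proj n k l).comp (pconjHom (vg v₂) (wd j₀ v₁ p)) = proj n k l := by
      apply FreeGroup.ext_hom
      intro u
      rw [MonoidHom.comp_apply, pconjHom_of]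
      split_ifs with h
      · rw [h, map_mul, map_mul, map_inv, hw]; simp
      · rfl
    exact DFunLike.congr_fun this w

/-- Conjugation by `y`. -/
def aAut (n l : ℕ) {k : ℕ} (j₀ : Fin k) : MulAut (FG n k l) :=
  MulAut.conj (FreeGroup.of (Sum.inr (Sum.inl j₀)))

lemma aAut_mem : aAut n l j₀ ∈ K n k l := by
  constructor
  · intro s
    exact isConj_iff.2 ⟨FreeGroup.of (Sum.inr (Sum.inl j₀)), by rw [aAut, MulAut.conj_apply]⟩
  · intro w
    simp [aAut, proj]

lemma ab_comm {v₁ v₂ : Fin n ⊕ Fin l} (hv : v₁ ≠ v₂) (p : ℤ) :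
    bAut j₀ hv p * aAut n l j₀ = aAut n l j₀ * bAut j₀ hv p := by
  ext1 u
  have h2 := (vg_ne_y (k := k) v₂ j₀).symm
  simp only [MulAut.mul_apply, aAut, MulAut.conj_apply, map_mul, map_inv, bAut_apply,
    pconjHom_of, h2, if_false]

lemma fox_y : fox j₀ (FreeGroup.of (Sum.inr (Sum.inl j₀)) : FG n k l) = ⟨0, 1⟩ := by
  simp [fox, foxGen]

lemma D_a (v : Fin n ⊕ Fin l) : D j₀ (aAut n l j₀ (FreeGroup.of (vg v))) = 1 - T 1 := by
  simp [D, aAut, fox_y, fox_vg, sub_eq_add_neg]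

lemma tm_a : tm j₀ (aAut n l j₀) = 1 := by
  simp [tm, D, aAut, fox_y]

lemma D_b_one {v₁ v₂ : Fin n ⊕ Fin l} (hv : v₁ ≠ v₂) (p : ℤ) :
    D j₀ (bAut j₀ hv p (FreeGroup.of (vg v₁))) = 0 := by
  have h1 : (vg v₁ : Gen n k l) ≠ vg v₂ := fun h => hv (vg_inj h)
  simp [D, bAut_apply, pconjHom_of, h1, fox_vg]

lemma fox_wd (v₁ : Fin n ⊕ Fin l) (p : ℤ) :
    fox j₀ (wd j₀ v₁ p : FG n k l) = ⟨0, T p⟩ := by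
  have hz : (⟨1, 0⟩ : Aff) ^ p = ⟨p, 0⟩ := by
    let e : Multiplicative ℤ →* Aff :=
      { toFun := fun m => ⟨m.toAdd, 0⟩
        map_one' := rfl
        map_mul' := by intro a b; ext1 <;> simp }
    have := map_zpow e (Multiplicative.ofAdd 1) p
    rw [← Int.ofAdd_mul, one_mul] at this
    exact this.symm
  rw [wd, map_mul, map_mul, map_inv, map_zpow, fox_vg, fox_y, hz]
  ext1 <;> simp

lemma D_b_two {v₁ v₂ : Fin n ⊕ Fin l} (hv : v₁ ≠ v₂) (p : ℤ) :
    D j₀ (bAut j₀ hv p (FreeGroup.of (vg v₂))) = (1 - T 1) * T p := by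
  rw [bAut_apply, pconjHom_of, if_pos rfl, D, map_mul, map_mul, map_inv, fox_wd, fox_vg]
  simp only [Aff.mul_val, Aff.mul_deg, Aff.inv_val, zero_add, add_zero, mul_zero, neg_zero,
    T_zero, one_mul]
  ring

/-- The linear functional on 2-chains. -/
noncomputable def Phi (v₁ v₂ : Fin n ⊕ Fin l) : ((K n k l × K n k l) →₀ ℚ) →ₗ[ℚ] LR :=
  Finsupp.lift LR ℚ (K n k l × K n k l) (coc j₀ v₁ v₂)

lemma Phi_single (v₁ v₂ : Fin n ⊕ Fin l) (p : K n k l × K n k l) :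
    Phi j₀ v₁ v₂ (Finsupp.single p 1) = coc j₀ v₁ v₂ p := by
  simp [Phi]

lemma Phi_d3 (v₁ v₂ : Fin n ⊕ Fin l) :
    (Phi j₀ v₁ v₂).comp (GroupH2.d3 (K n k l)) = 0 := by
  ext1 t
  ext1
  simp only [LinearMap.comp_apply, Finsupp.lsingle_apply, GroupH2.d3, Finsupp.lift_apply,
    LinearMap.zero_apply]
  rw [Finsupp.sum_single_index (by simp), one_smul]
  simp only [map_sub, map_add, Phi_single]
  exact coc_cocycle j₀ v₁ v₂ _ _ _

/-- **Theorem B.**  If `k ≥ 1` and `n + l ≥ 2`, then `H₂(K_{n,k,l}; ℚ)` has infinite rank,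
i.e. it is infinite-dimensional as a `ℚ`-vector space. -/
theorem K_H2_infinite_rank (n k l : ℕ) (hk : 1 ≤ k) (hnl : 2 ≤ n + l) :
    ¬ Module.Finite ℚ (GroupH2.H2 ↥(K n k l)) := by
  intro hfin
  have hfin' : Module.Finite ℚ (↥(GroupH2.Z2 ↥(K n k l)) ⧸ GroupH2.B2 ↥(K n k l)) := hfin
  let j₀ : Fin k := ⟨0, hk⟩
  have hnt : Nontrivial (Fin n ⊕ Fin l) := by
    rw [← Fintype.one_lt_card_iff_nontrivial]
    simp; omega
  obtain ⟨v₁, v₂, hv⟩ := hnt.exists_pair_ne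
  let Ψ : (↥(GroupH2.Z2 ↥(K n k l)) ⧸ GroupH2.B2 ↥(K n k l)) →ₗ[ℚ] LR :=
    (GroupH2.B2 ↥(K n k l)).liftQ ((Phi j₀ v₁ v₂).comp (GroupH2.Z2 ↥(K n k l)).subtype) (by
      rintro z ⟨t, ht⟩
      rw [LinearMap.mem_ker, LinearMap.comp_apply, ← ht]
      exact DFunLike.congr_fun (Phi_d3 j₀ v₁ v₂) t)
  let q : LR := (1 - T (-1)) * (1 - T 1)
  have hT : ∀ m : ℤ, m ≠ 0 → (1 - T m : LR) ≠ 0 := by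
    intro m hm h
    have h' : (T 0 : LR) = T m := by rw [T_zero]; exact sub_eq_zero.1 h
    have h2 := congrArg (fun r : LR => r.coeff m) h'
    simp only [T_apply, if_true, if_neg (Ne.symm hm)] at h2
    exact zero_ne_one h2
  have hq : q ≠ 0 := mul_ne_zero (hT _ (by norm_num)) (hT _ (by norm_num))
  have hrange : ∀ r : LR, q * r ∈ LinearMap.range Ψ := by
    intro r
    have hmon : ∀ p : ℤ, q * T p ∈ LinearMap.range Ψ := by
      intro p
      let a : K n k l := ⟨aAut n l j₀, aAut_mem j₀⟩
      let b : K n k l := ⟨bAut j₀ hv p, bAut_mem j₀ hv p⟩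
      have hab : b * a = a * b := Subtype.ext (ab_comm j₀ hv p)
      let z : ((K n k l × K n k l) →₀ ℚ) := Finsupp.single (a, b) 1 - Finsupp.single (b, a) 1
      have hz : z ∈ GroupH2.Z2 (K n k l) := by
        rw [GroupH2.Z2, LinearMap.mem_ker, GroupH2.d2, map_sub]
        simp only [Finsupp.lift_apply]
        rw [Finsupp.sum_single_index (by simp), Finsupp.sum_single_index (by simp), hab]
        simp only [one_smul]
        abel
      refine ⟨Submodule.Quotient.mk ⟨z, hz⟩, ?_⟩
      change Phi j₀ v₁ v₂ z = _
      rw [map_sub, Phi_single, Phi_single]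
      simp only [coc, a, b, D_a, D_b_one, D_b_two, tm_a, map_sub, map_one, invert_T, map_zero, q]
      ring
    induction r using LaurentPolynomial.induction_on' with
    | add x y hx hy => rw [mul_add]; exact add_mem hx hy
    | C_mul_T m c =>
      have : q * (C c * T m) = c • (q * T m) := by
        rw [Algebra.smul_def]
        change _ = C c * _
        ring
      rw [this]
      exact Submodule.smul_mem _ _ (hmon m)
  have hr : Module.Finite ℚ (LinearMap.range Ψ) := inferInstance
  let M : LR →ₗ[ℚ] LinearMap.range Ψ := (LinearMap.mulLeft ℚ q).codRestrict _ hrange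
  have hM : Function.Injective M := by
    intro x y hxy
    exact mul_left_cancel₀ hq (congrArg Subtype.val hxy)
  have hfinLR : Module.Finite ℚ LR := Module.Finite.of_injective M hM
  have hT' : LinearIndependent ℚ (fun m : ℤ => (T m : LR)) := by
    rw [linearIndependent_iff']
    intro s g h i hi
    have h2 := congrArg (fun r : LR => r.coeff i) h
    simpa [AddMonoidAlgebra.coeff_sum, Finsupp.finset_sum_apply, hi] using h2
  exact not_finite_iff_infinite.2 (inferInstance : Infinite ℤ) hT'.finite

end Birman
end
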